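/- arXiv:math/0309291 — 3 statements merged into one kernel-verified Lean document; each statement's English description precedes it below -/
import Mathlib

section
/- Let F be the free group on a finite set of k generators, φ : F → G a surjective group homomorphism onto a group G, and N = ker φ. Suppose N is generated as a group by a set of elements each of reduced word length at most M in F. Let S ⊆ G be the set of images under φ of the free generators and their inverses, and let d be the word metric on G with respect to S. Then every rigid triple in (G,d) has perimeter at most 3M/2; consequently, every weakly-geodesic ray γ in (G,d) admits a geodesic ray γ' with lim_{t} (d(γ(t),y) − d(γ(t),z)) = lim_{t} (d(γ'(t),y) − d(γ'(t),z)) for all y,z ∈ G, i.e. every point of the metric boundary of the Cayley graph of (G,S) is a Busemann point. -/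
open Filter Topology

/-- `T` is a valid domain for a ray: an unbounded subset of `[0,∞)` containing `0`. -/
def IsRayDomain (T : Set ℝ) : Prop :=
  T ⊆ Set.Ici (0 : ℝ) ∧ 0 ∈ T ∧ ∀ M : ℝ, ∃ t ∈ T, M < t

/-- A weakly-geodesic ray for the distance function `d`. -/
def WeaklyGeodesicRay {X : Type*} (d : X → X → ℝ) (T : Set ℝ) (γ : ℝ → X) : Prop :=
  ∀ y : X, ∀ ε : ℝ, 0 < ε → ∃ N : ℝ, ∀ s ∈ T, ∀ t ∈ T, N ≤ s → N ≤ t →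
    |d (γ t) (γ 0) - t| < ε ∧ |d (γ t) y - d (γ s) y - (t - s)| < ε

/-- An almost-geodesic ray for the distance function `d`. -/
def AlmostGeodesicRay {X : Type*} (d : X → X → ℝ) (T : Set ℝ) (γ : ℝ → X) : Prop :=
  ∀ ε : ℝ, 0 < ε → ∃ N : ℝ, ∀ s ∈ T, ∀ t ∈ T, N ≤ s → s ≤ t →
    |d (γ t) (γ s) + d (γ s) (γ 0) - t| < ε

/-- A geodesic ray for the distance function `d`. -/
def GeodesicRay {X : Type*} (d : X → X → ℝ) (T : Set ℝ) (γ : ℝ → X) : Prop :=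
  ∀ s ∈ T, ∀ t ∈ T, d (γ s) (γ t) = |s - t|

/-- `L` is the limit of `d(γ(t),y) - d(γ(t),z)` as `t → ∞` along `T`. -/
def RayLimit {X : Type*} (d : X → X → ℝ) (T : Set ℝ) (γ : ℝ → X) (y z : X) (L : ℝ) : Prop :=
  Tendsto (fun t => d (γ t) y - d (γ t) z) (atTop ⊓ 𝓟 T) (𝓝 L)

/-- Minimal paths from `a` to `c` and from `b` to `c` share a tail: there is a vertex
`z ≠ c` lying simultaneously on a minimal path from `a` to `c` and on one from `b` to `c`. -/
def ShareTail {V : Type*} (d : V → V → ℕ) (a b c : V) : Prop :=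
  ∃ z, z ≠ c ∧ d a z + d z c = d a c ∧ d b z + d z c = d b c

/-- No minimal paths from apex `x` to `y` and from `x` to `z` share a vertex other than `x`. -/
def RigidApex {V : Type*} (d : V → V → ℕ) (x y z : V) : Prop :=
  ∀ w, w ≠ x → ¬(d x w + d w y = d x y ∧ d x w + d w z = d x z)

/-- A rigid triple: three distinct vertices, rigid at each apex. -/
def RigidTriple {V : Type*} (d : V → V → ℕ) (x y z : V) : Prop :=
  x ≠ y ∧ y ≠ z ∧ x ≠ z ∧
    RigidApex d x y z ∧ RigidApex d y x z ∧ RigidApex d z x y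

/-- The word metric on a group `G` with respect to a generating set `S`:
`wordDist S g h` is the least `n` such that `g⁻¹ * h` is a product of `n` elements of `S`. -/
noncomputable def wordDist {G : Type*} [Group G] (S : Set G) (g h : G) : ℕ :=
  sInf {n | ∃ l : List G, l.length = n ∧ (∀ x ∈ l, x ∈ S) ∧ l.prod = g⁻¹ * h}

/-- The symmetric generating set of `G` consisting of the images of the free generators
and their inverses under `φ`. -/
def genSet {k : ℕ} {G : Type*} [Group G] (φ : FreeGroup (Fin k) →* G) : Set G :=
  {g | ∃ i : Fin k, g = φ (FreeGroup.of i) ∨ g = (φ (FreeGroup.of i))⁻¹}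


section helpers
open FreeGroup

/-- Length of the longest common prefix. -/
def lcpLen {β : Type*} [DecidableEq β] : List β → List β → ℕ
  | a :: A, b :: B => if a = b then lcpLen A B + 1 else 0
  | [], _ => 0
  | _ :: _, [] => 0

theorem lcpLen_append_left {β : Type*} [DecidableEq β] (p r q : List β)
    (h : q.length ≤ p.length) : lcpLen (p ++ r) q = lcpLen p q := by
  induction p generalizing q with
  | nil =>
    have : q = [] := by simpa using h
    subst this
    cases r <;> simp [lcpLen]
  | cons a p ih =>
    cases q with
    | nil => simp [lcpLen]
    | cons b q =>
      simp only [List.cons_append, lcpLen]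
      rw [ih q (by simpa using h)]

theorem lcpLen_append_self {β : Type*} [DecidableEq β] (p r : List β) :
    lcpLen (p ++ r) p = p.length := by
  induction p with
  | nil => cases r <;> simp [lcpLen]
  | cons a p ih => simp [lcpLen, ih]

theorem prefix_of_lcpLen {β : Type*} [DecidableEq β] (w p : List β)
    (h : lcpLen w p = p.length) : p <+: w := by
  induction p generalizing w with
  | nil => simp
  | cons a p ih =>
    cases w with
    | nil => simp [lcpLen] at h
    | cons b w =>
      simp only [lcpLen] at h
      split_ifs at h with hb
      · subst hb
        simpa using ih w (by simpa using h)

theorem isReduced_invRev {α : Type*} [DecidableEq α] {A : List (α × Bool)} (h : IsReduced A) :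
    IsReduced (invRev A) := by
  rw [isReduced_iff_reduce_eq] at *
  rw [reduce_invRev, h]

theorem lcp_split {α : Type*} [DecidableEq α] (A B : List (α × Bool))
    (hA : IsReduced A) (hB : IsReduced B) :
    ∃ C A' B', A = C ++ A' ∧ B = C ++ B' ∧ C.length = lcpLen A B ∧
      IsReduced (invRev A' ++ B') := by
  induction A generalizing B with
  | nil => exact ⟨[], [], B, rfl, rfl, by simp [lcpLen], by simpa using hB⟩
  | cons a A ih =>
    cases B with
    | nil => exact ⟨[], a :: A, [], rfl, rfl, by simp [lcpLen], by simpa using isReduced_invRev hA⟩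
    | cons b B =>
      by_cases hab : a = b
      · subst hab
        obtain ⟨C, A', B', h1, h2, h3, h4⟩ := ih B (hA.infix (List.infix_cons (List.infix_refl _)))
          (hB.infix (List.infix_cons (List.infix_refl _)))
        exact ⟨a :: C, A', B', by simp [h1], by simp [h2], by simp [lcpLen, h3], h4⟩
      · refine ⟨[], a :: A, b :: B, rfl, rfl, by simp [lcpLen, hab], ?_⟩
        have h1 := isReduced_invRev hA
        rw [invRev_cons] at h1 ⊢
        refine h1.append_overlap ?_ (by simp [invRev])
        have : invRev [a] = [(a.1, !a.2)] := by simp [invRev]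
        rw [this, List.singleton_append]
        refine List.isChain_cons_cons.2 ⟨?_, hB⟩
        rcases a with ⟨a1, a2⟩
        rcases b with ⟨b1, b2⟩
        simp only [Prod.mk.injEq] at hab ⊢
        intro h
        cases a2 <;> cases b2 <;> simp_all

theorem norm_mk_of_isReduced {α : Type*} [DecidableEq α] {A : List (α × Bool)}
    (h : IsReduced A) : (mk A).norm = A.length := by
  rw [FreeGroup.norm, toWord_mk, h.reduce_eq]

theorem norm_lcp {α : Type*} [DecidableEq α] (A B : List (α × Bool))
    (hA : IsReduced A) (hB : IsReduced B) :
    ((mk A)⁻¹ * mk B).norm + 2 * lcpLen A B = A.length + B.length := by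
  obtain ⟨C, A', B', h1, h2, h3, h4⟩ := lcp_split A B hA hB
  have : (mk A)⁻¹ * mk B = mk (invRev A' ++ B') := by
    rw [h1, h2, ← mul_mk, ← mul_mk, ← mul_mk, ← inv_mk]; group
  rw [this, norm_mk_of_isReduced h4, ← h3, h1, h2]
  simp
  omega

/-- Word distance upper bound. -/
theorem wordDist_le {k : ℕ} {G : Type*} [Group G] (φ : FreeGroup (Fin k) →* G)
    (u : FreeGroup (Fin k)) (g h : G) (hu : φ u = g⁻¹ * h) :
    wordDist (genSet φ) g h ≤ u.norm := by
  apply Nat.sInf_le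
  refine ⟨u.toWord.map (fun x => φ (mk [x])), by simp [FreeGroup.norm], ?_, ?_⟩
  · intro x hx
    obtain ⟨⟨i, b⟩, -, rfl⟩ := List.mem_map.1 hx
    refine ⟨i, ?_⟩
    cases b
    · right
      rw [← _root_.map_inv]; rfl
    · left; rfl
  · rw [← hu]
    conv_rhs => rw [← mk_toWord (x := u)]
    induction u.toWord with
    | nil => simp [← one_eq_mk]
    | cons a l ih =>
      rw [List.map_cons, List.prod_cons, ih, ← _root_.map_mul, mul_mk]; rfl

theorem exists_norm_le {k : ℕ} {G : Type*} [Group G] (φ : FreeGroup (Fin k) →* G)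
    (l : List G) (hl : ∀ x ∈ l, x ∈ genSet φ) :
    ∃ u : FreeGroup (Fin k), φ u = l.prod ∧ u.norm ≤ l.length := by
  induction l with
  | nil => exact ⟨1, by simp⟩
  | cons a l ih =>
    obtain ⟨u, hu, hn⟩ := ih (fun x hx => hl x (List.mem_cons_of_mem _ hx))
    obtain ⟨i, hi | hi⟩ := hl a List.mem_cons_self
    · refine ⟨of i * u, by simp [hu, hi], (FreeGroup.norm_mul_le _ _).trans ?_⟩
      simp; omega
    · refine ⟨(of i)⁻¹ * u, by simp [hu, hi], (FreeGroup.norm_mul_le _ _).trans ?_⟩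
      simp; omega

theorem exists_wordDist {k : ℕ} {G : Type*} [Group G] (φ : FreeGroup (Fin k) →* G)
    (hsurj : Function.Surjective φ) (g h : G) :
    ∃ u : FreeGroup (Fin k), φ u = g⁻¹ * h ∧ u.norm = wordDist (genSet φ) g h := by
  have hne : {n | ∃ l : List G, l.length = n ∧ (∀ x ∈ l, x ∈ genSet φ) ∧
      l.prod = g⁻¹ * h}.Nonempty := by
    obtain ⟨u, hu⟩ := hsurj (g⁻¹ * h)
    refine ⟨_, u.toWord.map (fun x => φ (mk [x])), rfl, ?_, ?_⟩
    · intro x hx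
      obtain ⟨⟨i, b⟩, -, rfl⟩ := List.mem_map.1 hx
      refine ⟨i, ?_⟩
      cases b
      · right
        rw [← _root_.map_inv]; rfl
      · left; rfl
    · rw [← hu]
      conv_rhs => rw [← mk_toWord (x := u)]
      induction u.toWord with
      | nil => simp [← one_eq_mk]
      | cons a l ih =>
        rw [List.map_cons, List.prod_cons, ih, ← _root_.map_mul, mul_mk]; rfl
  obtain ⟨l, h1, h2, h3⟩ := Nat.sInf_mem hne
  obtain ⟨u, hu, hn⟩ := exists_norm_le φ l h2
  refine ⟨u, hu.trans h3, le_antisymm (hn.trans h1.le) (wordDist_le φ u g h (hu.trans h3))⟩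

theorem wordDist_free {k : ℕ} {G : Type*} [Group G] (φ : FreeGroup (Fin k) →* G)
    (hsurj : Function.Surjective φ) (hinj : Function.Injective φ) (a b : FreeGroup (Fin k)) :
    wordDist (genSet φ) (φ a) (φ b) = (a⁻¹ * b).norm := by
  obtain ⟨u, hu, hn⟩ := exists_wordDist φ hsurj (φ a) (φ b)
  rw [← _root_.map_inv, ← _root_.map_mul] at hu
  rw [← hinj hu, hn]

/-- Any prefix of a kernel element is within half the length of the identity. -/
theorem half_bound {k : ℕ} {G : Type*} [Group G] (φ : FreeGroup (Fin k) →* G)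
    (M : ℕ) (R : Set (FreeGroup (Fin k)))
    (hR : Subgroup.closure R = φ.ker)
    (hRM : ∀ r ∈ R, (FreeGroup.toWord r).length ≤ M) (u : FreeGroup (Fin k)) (hu : φ u = 1) :
    ∀ p : List (Fin k × Bool), p <+: u.toWord → 2 * wordDist (genSet φ) 1 (φ (mk p)) ≤ M := by
  have hmem : u ∈ Subgroup.closure R := by rw [hR]; exact hu
  clear hu
  have key : ∀ u ∈ Subgroup.closure R, φ u = 1 := fun u h => by rw [hR] at h; exact h
  induction hmem using Subgroup.closure_induction with
  | mem r hr =>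
    rintro p ⟨s, hs⟩
    have h1 : φ r = 1 := key r (Subgroup.subset_closure hr)
    have h2 := hRM r hr
    have h3 : wordDist (genSet φ) 1 (φ (mk p)) ≤ p.length :=
      (wordDist_le φ (mk p) 1 _ (by simp)).trans norm_mk_le
    have h4 : wordDist (genSet φ) 1 (φ (mk p)) ≤ s.length := by
      refine (wordDist_le φ (mk s)⁻¹ 1 _ ?_).trans ?_
      · have : φ (mk p) * φ (mk s) = 1 := by
          rw [← _root_.map_mul, mul_mk, hs, mk_toWord, h1]
        rw [_root_.map_inv, inv_one, one_mul]
        exact (eq_inv_of_mul_eq_one_left this).symm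
      · rw [norm_inv_eq]; exact norm_mk_le
    rw [← hs, List.length_append] at h2
    omega
  | one =>
    intro p hp
    have : p = [] := by simpa using hp
    subst this
    have : wordDist (genSet φ) 1 (φ (mk [])) ≤ (1 : FreeGroup (Fin k)).norm :=
      wordDist_le φ 1 _ _ (by rw [← one_eq_mk]; simp)
    simp at this
    simp [this]
  | mul u v hu hv ihu ihv =>
    rintro p hp
    obtain ⟨C, A', B', h1, h2, -, h4⟩ := lcp_split u.toWord (u * v).toWord
      isReduced_toWord isReduced_toWord
    have h5 : φ u = 1 := key u hu
    rcases List.prefix_or_prefix_of_prefix hp (h2 ▸ List.prefix_append C B') with h | ⟨p', rfl⟩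
    · exact ihu p (h.trans (h1 ▸ List.prefix_append C A'))
    · rw [h2] at hp
      obtain ⟨s, hs⟩ := hp
      rw [List.append_assoc, List.append_cancel_left_eq] at hs
      have hv' : v.toWord = invRev A' ++ B' := by
        have : v = mk (invRev A' ++ B') := by
          have e : v = u⁻¹ * (u * v) := by group
          have e1 : u = mk C * mk A' := by rw [mul_mk, ← h1, mk_toWord]
          have e2 : u * v = mk C * mk B' := by rw [mul_mk, ← h2, mk_toWord]
          rw [e, e2, e1, ← mul_mk, ← inv_mk]
          group
        rw [this, toWord_mk, h4.reduce_eq]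
      have h6 := ihv (invRev A' ++ p') ⟨s, by rw [hv', ← hs]; simp⟩
      have h7 : φ (mk (C ++ p')) = φ (mk (invRev A' ++ p')) := by
        have e : mk (C ++ p') = u * mk (invRev A' ++ p') := by
          conv_rhs => rw [← mk_toWord (x := u)]
          rw [h1, ← mul_mk, ← mul_mk, ← mul_mk, ← inv_mk]
          group
        rw [e, _root_.map_mul, h5, one_mul]
      rw [h7]; exact h6
  | inv u hu ihu =>
    rintro p ⟨s, hs⟩
    have h1 := key u hu
    rw [toWord_inv] at hs
    have h2 : invRev s ++ invRev p = u.toWord := by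
      rw [← invRev_append, hs, invRev_invRev]
    have h3 := ihu (invRev s) ⟨_, h2⟩
    have h4 : φ (mk (invRev s)) = φ (mk p) := by
      rw [← mk_toWord (x := u), ← h2, ← mul_mk, ← inv_mk (L := p), _root_.map_mul, _root_.map_inv] at h1
      exact mul_inv_eq_one.1 h1
    rwa [h4] at h3

theorem cyc_invRev {α : Type*} [DecidableEq α] {L : List (α × Bool)}
    (h : IsCyclicallyReduced L) : IsCyclicallyReduced (invRev L) := by
  rw [isCyclicallyReduced_iff] at *
  refine ⟨isReduced_invRev h.1, ?_⟩
  intro a ha b hb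
  simp only [invRev, List.getLast?_reverse, List.head?_reverse, List.head?_map, List.getLast?_map,
    Option.mem_def, Option.map_eq_some_iff] at ha hb
  obtain ⟨a', ha', rfl⟩ := ha
  obtain ⟨b', hb', rfl⟩ := hb
  have := h.2 b' hb' a' ha'
  grind

theorem append_cyc {α : Type*} [DecidableEq α] {A L : List (α × Bool)}
    (hA : IsReduced A) (h : IsCyclicallyReduced L) :
    IsReduced (A ++ L) ∨ IsReduced (A ++ invRev L) := by
  by_contra! hc
  obtain ⟨h1, h2⟩ := hc
  have hL := isReduced_invRev h.1
  rw [FreeGroup.IsReduced, List.isChain_append] at h1 h2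
  simp only [show List.IsChain _ A from hA, show List.IsChain _ L from h.1, true_and,
    show List.IsChain _ (invRev L) from hL] at h1 h2
  push Not at h1 h2
  obtain ⟨x, hx, b, hb, e1, e2⟩ := h1
  obtain ⟨x', hx', c, hc, e3, e4⟩ := h2
  simp only [invRev, List.head?_reverse, List.getLast?_map,
    Option.mem_def, Option.map_eq_some_iff] at hc
  obtain ⟨c', hc', rfl⟩ := hc
  have := h.2 c' hc' b hb
  have : x = x' := by
    rw [Option.mem_def] at hx hx'
    rw [hx] at hx'
    exact Option.some.inj hx'
  subst this
  grind

theorem diam_aux {k : ℕ} {G : Type*} [Group G] (φ : FreeGroup (Fin k) →* G)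
    (M : ℕ) (R : Set (FreeGroup (Fin k)))
    (hR : Subgroup.closure R = φ.ker)
    (hRM : ∀ r ∈ R, (FreeGroup.toWord r).length ≤ M) (A L : List (Fin k × Bool))
    (hL : IsCyclicallyReduced L) (hL0 : L ≠ []) (hφ : φ (mk L) = 1) (hAL : IsReduced (A ++ L)) :
    2 * wordDist (genSet φ) 1 (φ (mk A)) ≤ M := by
  set B := (List.replicate (A.length + 1) L).flatten with hB
  have hAB : IsReduced (A ++ B) := by
    have := IsReduced.append_flatten_replicate_append (L₁ := A) (L₃ := []) hL (by simpa using hAL)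
      (Nat.succ_ne_zero A.length)
    simpa using this
  have hBl : A.length ≤ B.length := by
    have : 0 < L.length := List.length_pos_iff.2 hL0
    simp [hB]
    nlinarith
  have hBφ : φ (mk B) = 1 := by
    rw [hB]
    generalize A.length + 1 = n
    induction n with
    | zero => simp [← one_eq_mk]
    | succ n ih => rw [List.replicate_succ, List.flatten_cons, ← mul_mk, _root_.map_mul, hφ, ih, one_mul]
  set u := mk (A ++ B) * (mk A)⁻¹ with hu
  have huφ : φ u = 1 := by
    rw [hu, ← mul_mk, _root_.map_mul, _root_.map_mul, hBφ, _root_.map_inv]; simp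
  apply half_bound φ M R hR hRM u huφ
  have h1 := norm_lcp (A ++ B) u.toWord hAB isReduced_toWord
  have h2 : (mk (A ++ B))⁻¹ * mk u.toWord = (mk A)⁻¹ := by rw [mk_toWord, hu]; group
  have h3 : ((mk A)⁻¹).norm ≤ A.length := by rw [norm_inv_eq]; exact norm_mk_le
  have h4 : (mk (A ++ B)).norm ≤ u.norm + (mk A).norm := by
    have : mk (A ++ B) = u * mk A := by rw [hu]; group
    rw [this]; exact FreeGroup.norm_mul_le _ _
  rw [norm_mk_of_isReduced hAB] at h4
  have h5 : (mk A).norm ≤ A.length := norm_mk_le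
  rw [h2] at h1
  rw [FreeGroup.norm] at h4
  simp only [List.length_append] at h1 h4
  obtain ⟨C, A', B', e1, e2, e3, -⟩ := lcp_split (A ++ B) u.toWord hAB isReduced_toWord
  have h6 : A <+: C := List.prefix_of_prefix_length_le (List.prefix_append A B)
    (e1 ▸ List.prefix_append C A') (by omega)
  exact h6.trans (e2 ▸ List.prefix_append C B')

theorem diam_bound {k : ℕ} {G : Type*} [Group G] (φ : FreeGroup (Fin k) →* G)
    (hsurj : Function.Surjective φ)
    (M : ℕ) (R : Set (FreeGroup (Fin k)))
    (hR : Subgroup.closure R = φ.ker)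
    (hRM : ∀ r ∈ R, (FreeGroup.toWord r).length ≤ M) (r : FreeGroup (Fin k)) (hr : r ≠ 1)
    (hr1 : φ r = 1) (g h : G) :
    2 * wordDist (genSet φ) g h ≤ M := by
  have htr : wordDist (genSet φ) g h = wordDist (genSet φ) 1 (g⁻¹ * h) := by
    simp [wordDist]
  rw [htr]
  obtain ⟨a, ha⟩ := hsurj (g⁻¹ * h)
  rw [← ha]
  set L := reduceCyclically r.toWord with hLdef
  have hL : IsCyclicallyReduced L := reduceCyclically.isCyclicallyReduced isReduced_toWord
  have hconj := reduceCyclically.conj_conjugator_reduceCyclically r.toWord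
  rw [← hLdef] at hconj
  have hrL : r = mk (reduceCyclically.conjugator r.toWord) * mk L *
      (mk (reduceCyclically.conjugator r.toWord))⁻¹ := by
    rw [inv_mk, mul_mk, mul_mk, hconj, mk_toWord]
  have hφ : φ (mk L) = 1 := by
    rw [hrL, _root_.map_mul, _root_.map_mul, _root_.map_inv] at hr1
    simpa using hr1
  have hL0 : L ≠ [] := by
    intro h0
    rw [h0, ← one_eq_mk] at hrL
    rw [hrL, mul_one, mul_inv_cancel] at hr
    exact hr rfl
  rw [← mk_toWord (x := a)]
  rcases append_cyc (isReduced_toWord (x := a)) hL with h1 | h1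
  · exact diam_aux φ M R hR hRM _ L hL hL0 hφ h1
  · refine diam_aux φ M R hR hRM _ (invRev L) (cyc_invRev hL) ?_ ?_ h1
    · intro h; apply hL0; have := congrArg invRev h; simpa using this
    · rw [← inv_mk, _root_.map_inv, hφ, inv_one]

theorem no_rigid_free {k : ℕ} {G : Type*} [Group G] (φ : FreeGroup (Fin k) →* G)
    (hsurj : Function.Surjective φ) (hinj : Function.Injective φ) (x y z : G) :
    ¬ RigidTriple (wordDist (genSet φ)) x y z := by
  rintro ⟨hxy, -, -, hx, hy, -⟩
  obtain ⟨a, rfl⟩ := hsurj x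
  obtain ⟨b, rfl⟩ := hsurj y
  obtain ⟨c, rfl⟩ := hsurj z
  obtain ⟨C, A', B', e1, e2, -, e4⟩ := lcp_split (a⁻¹ * b).toWord (a⁻¹ * c).toWord
    isReduced_toWord isReduced_toWord
  have r1 : IsReduced (C ++ A') := e1 ▸ isReduced_toWord
  have r2 : IsReduced (C ++ B') := e2 ▸ isReduced_toWord
  have rA : IsReduced A' := r1.infix (List.suffix_append C A').isInfix
  have rB : IsReduced B' := r2.infix (List.suffix_append C B').isInfix
  have rC : IsReduced C := r1.infix (List.prefix_append C A').isInfix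
  have f1 : a⁻¹ * b = mk C * mk A' := by rw [mul_mk, ← e1, mk_toWord]
  have f2 : a⁻¹ * c = mk C * mk B' := by rw [mul_mk, ← e2, mk_toWord]
  have f3 : b⁻¹ * c = mk (invRev A' ++ B') := by
    have : b⁻¹ * c = (a⁻¹ * b)⁻¹ * (a⁻¹ * c) := by group
    rw [this, f1, f2, ← mul_mk, ← inv_mk]; group
  have f4 : (a * mk C)⁻¹ * b = mk A' := by
    have : (a * mk C)⁻¹ * b = (mk C)⁻¹ * (a⁻¹ * b) := by group
    rw [this, f1]; group
  have f5 : (a * mk C)⁻¹ * c = mk B' := by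
    have : (a * mk C)⁻¹ * c = (mk C)⁻¹ * (a⁻¹ * c) := by group
    rw [this, f2]; group
  have f6 : a⁻¹ * (a * mk C) = mk C := by group
  by_cases hC : C = []
  · subst hC
    have f7 : b⁻¹ * a = (mk A')⁻¹ := by
      have : b⁻¹ * a = (a⁻¹ * b)⁻¹ := by group
      rw [this, f1, ← one_eq_mk]; group
    refine hy (φ a) hxy ⟨?_, ?_⟩
    · simp only [wordDist_free φ hsurj hinj]; simp
    · simp only [wordDist_free φ hsurj hinj]
      rw [f7, f3, f2, mul_mk, norm_inv_eq, norm_mk_of_isReduced e4, norm_mk_of_isReduced rA,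
        norm_mk_of_isReduced r2]
      simp
  · refine hx (φ (a * mk C)) ?_ ⟨?_, ?_⟩
    · intro h
      have h' := hinj h
      have : mk C = 1 := by simpa using h'
      have h2 := norm_mk_of_isReduced rC
      rw [this] at h2
      simp at h2
      exact hC (List.length_eq_zero_iff.1 h2.symm)
    · simp only [wordDist_free φ hsurj hinj]
      rw [f6, f4, f1, mul_mk, norm_mk_of_isReduced rC, norm_mk_of_isReduced rA,
        norm_mk_of_isReduced r1]
      simp
    · simp only [wordDist_free φ hsurj hinj]
      rw [f6, f5, f2, mul_mk, norm_mk_of_isReduced rC, norm_mk_of_isReduced rB,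
        norm_mk_of_isReduced r2]
      simp

theorem busemann_free {k : ℕ} {G : Type*} [Group G] (φ : FreeGroup (Fin k) →* G)
    (hsurj : Function.Surjective φ) (hinj : Function.Injective φ)
    (T : Set ℝ) (γ : ℝ → G) (hT : IsRayDomain T)
    (hγ : WeaklyGeodesicRay (fun g h => (wordDist (genSet φ) g h : ℝ)) T γ) :
      ∃ (T' : Set ℝ) (γ' : ℝ → G), IsRayDomain T' ∧
        GeodesicRay (fun g h => (wordDist (genSet φ) g h : ℝ)) T' γ' ∧
        ∀ y z : G, ∃ L : ℝ,
          RayLimit (fun g h => (wordDist (genSet φ) g h : ℝ)) T γ y z L ∧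
          RayLimit (fun g h => (wordDist (genSet φ) g h : ℝ)) T' γ' y z L := by
  choose c hc using fun t => hsurj (γ t)
  obtain ⟨W, hW⟩ : ∃ W : ℝ → List (Fin k × Bool), ∀ t, W t = ((c 0)⁻¹ * c t).toWord :=
    ⟨_, fun _ => rfl⟩
  have hWr : ∀ t, FreeGroup.IsReduced (W t) := fun t => by rw [hW]; exact isReduced_toWord
  have hWc : ∀ t, mk (W t) = (c 0)⁻¹ * c t := fun t => by rw [hW, mk_toWord]
  -- distance formula between translated reduced words
  have hdist : ∀ p q, FreeGroup.IsReduced p → FreeGroup.IsReduced q →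
      wordDist (genSet φ) (φ (c 0 * mk p)) (φ (c 0 * mk q)) + 2 * lcpLen p q
        = p.length + q.length := by
    intro p q hp hq
    rw [wordDist_free φ hsurj hinj, ← norm_lcp p q hp hq]
    congr 2
    group
  have hγW : ∀ t, γ t = φ (c 0 * mk (W t)) := by
    intro t; rw [hWc, mul_inv_cancel_left, hc]
  have hγ0 : γ 0 = φ (c 0 * mk []) := by rw [← one_eq_mk, mul_one, hc]
  have hl0 : ∀ p : List (Fin k × Bool), lcpLen p [] = 0 := by
    intro p; cases p <;> simp [lcpLen]
  have hD0 : ∀ t, wordDist (genSet φ) (γ t) (γ 0) = (W t).length := by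
    intro t
    have := hdist (W t) [] (hWr t) IsReduced.nil
    rw [hl0] at this
    rw [hγ0, hγW t]
    simpa using this
  have hne : (atTop ⊓ 𝓟 T : Filter ℝ).NeBot := by
    rw [← frequently_mem_iff_neBot, frequently_atTop]
    intro a
    obtain ⟨t, ht, h⟩ := hT.2.2 a
    exact ⟨t, h.le, ht⟩
  have hev : ∀ (P : ℝ → Prop) (N : ℝ), (∀ t ∈ T, N ≤ t → P t) → ∀ᶠ t in atTop ⊓ 𝓟 T, P t := by
    intro P N h
    rw [eventually_inf_principal]
    filter_upwards [eventually_ge_atTop N] with t ht hT using h t hT ht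
  have hlen : ∀ n : ℕ, ∀ᶠ t in atTop ⊓ 𝓟 T, n ≤ (W t).length := by
    intro n
    obtain ⟨N, hN⟩ := hγ (γ 0) 1 one_pos
    refine hev _ (max N (n + 1)) fun t ht h => ?_
    have h1 := (hN t ht t ht ((le_max_left _ _).trans h) ((le_max_left _ _).trans h)).1
    simp only [hD0] at h1
    have h2 := (le_max_right _ _).trans h
    rw [abs_lt] at h1
    have : (n : ℝ) ≤ (W t).length := by linarith
    exact_mod_cast this
  have hpre : ∀ p, FreeGroup.IsReduced p →
      (∀ᶠ t in atTop ⊓ 𝓟 T, p <+: W t) ∨ (∀ᶠ t in atTop ⊓ 𝓟 T, ¬ p <+: W t) := by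
    intro p hp
    obtain ⟨N, hN⟩ := hγ (φ (c 0 * mk p)) (1 / 4) (by norm_num)
    have hconst : ∀ s ∈ T, ∀ t ∈ T, N ≤ s → N ≤ t → lcpLen (W s) p = lcpLen (W t) p := by
      intro s hs t ht hNs hNt
      obtain ⟨h1, h2⟩ := hN s hs t ht hNs hNt
      obtain ⟨h3, -⟩ := hN t ht s hs hNt hNs
      have h4 := hdist (W s) p (hWr s) hp
      have h5 := hdist (W t) p (hWr t) hp
      rw [← hγW] at h4 h5
      simp only [hD0] at h1 h3
      have h4' : (wordDist (genSet φ) (γ s) (φ (c 0 * mk p)) : ℝ) + 2 * lcpLen (W s) p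
        = (W s).length + p.length := by exact_mod_cast h4
      have h5' : (wordDist (genSet φ) (γ t) (φ (c 0 * mk p)) : ℝ) + 2 * lcpLen (W t) p
        = (W t).length + p.length := by exact_mod_cast h5
      rw [abs_lt] at h1 h2 h3
      have h6 : (lcpLen (W s) p : ℝ) < lcpLen (W t) p + 1 := by linarith
      have h7 : (lcpLen (W t) p : ℝ) < lcpLen (W s) p + 1 := by linarith
      have h6' : lcpLen (W s) p < lcpLen (W t) p + 1 := by exact_mod_cast h6
      have h7' : lcpLen (W t) p < lcpLen (W s) p + 1 := by exact_mod_cast h7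
      omega
    by_cases hs : ∃ s ∈ T, N ≤ s ∧ p <+: W s
    · obtain ⟨s, hs, hNs, r, hr⟩ := hs
      left
      refine hev _ N fun t ht hNt => prefix_of_lcpLen _ _ ?_
      rw [← hconst s hs t ht hNs hNt, ← hr, lcpLen_append_self]
    · push Not at hs
      right
      exact hev _ N fun t ht hNt => hs t ht hNt
  have hex : ∀ n : ℕ, ∃ p : List (Fin k × Bool), p.length = n ∧ FreeGroup.IsReduced p ∧
      ∀ᶠ t in atTop ⊓ 𝓟 T, p <+: W t := by
    intro n
    by_contra! hcon
    have h1 : ∀ᶠ t in atTop ⊓ 𝓟 T, ∀ p ∈ {l : List (Fin k × Bool) | l.length = n},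
        ¬ p <+: W t := by
      rw [eventually_all_finite (List.finite_length_eq _ n)]
      intro p hp
      by_cases hpr : FreeGroup.IsReduced p
      · rcases hpre p hpr with h | h
        · exact absurd h (by simpa using hcon p hp hpr)
        · exact h
      · exact Eventually.of_forall fun t ht => hpr ((hWr t).infix ht.isInfix)
    obtain ⟨t, ht1, ht2⟩ := (h1.and (hlen n)).exists
    exact ht1 ((W t).take n) (by simpa using ht2) (List.take_prefix _ _)
  choose P hPl hPr hPe using hex
  have hPP : ∀ n m, n ≤ m → P n <+: P m := by
    intro n m hnm
    obtain ⟨t, h1, h2⟩ := ((hPe n).and (hPe m)).exists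
    exact List.prefix_of_prefix_length_le h1 h2 (by simp [hPl, hnm])
  have hPd : ∀ n m, n ≤ m → (wordDist (genSet φ) (φ (c 0 * mk (P m))) (φ (c 0 * mk (P n))) = m - n
      ∧ wordDist (genSet φ) (φ (c 0 * mk (P n))) (φ (c 0 * mk (P m))) = m - n) := by
    intro n m hnm
    have h1 := hdist (P m) (P n) (hPr m) (hPr n)
    have h3 : lcpLen (P m) (P n) = n := by
      obtain ⟨r, hr⟩ := hPP n m hnm
      rw [← hr, lcpLen_append_self, hPl]
    rw [h3, hPl, hPl] at h1
    have h4 : wordDist (genSet φ) (φ (c 0 * mk (P n))) (φ (c 0 * mk (P m))) =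
        wordDist (genSet φ) (φ (c 0 * mk (P m))) (φ (c 0 * mk (P n))) := by
      rw [wordDist_free φ hsurj hinj, wordDist_free φ hsurj hinj, ← norm_inv_eq]
      congr 1
      group
    omega
  refine ⟨Set.range (fun n : ℕ => (n : ℝ)), fun t => φ (c 0 * mk (P ⌊t⌋₊)), ⟨?_, ⟨0, by simp⟩, ?_⟩,
    ?_, ?_⟩
  · rintro _ ⟨n, rfl⟩
    simp
  · intro M
    obtain ⟨n, hn⟩ := exists_nat_gt M
    exact ⟨n, ⟨n, rfl⟩, hn⟩
  · rintro _ ⟨n, rfl⟩ _ ⟨m, rfl⟩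
    simp only [Nat.floor_natCast]
    rcases le_total n m with h | h
    · have h' : (n : ℝ) ≤ m := by exact_mod_cast h
      rw [(hPd n m h).2, Nat.cast_sub h, abs_of_nonpos (by linarith)]
      ring
    · have h' : (m : ℝ) ≤ n := by exact_mod_cast h
      rw [(hPd m n h).1, Nat.cast_sub h, abs_of_nonneg (by linarith)]
  · intro y z
    have hy : ∀ y : G, ∃ q, FreeGroup.IsReduced q ∧ y = φ (c 0 * mk q) := by
      intro y
      obtain ⟨b, rfl⟩ := hsurj y
      exact ⟨((c 0)⁻¹ * b).toWord, isReduced_toWord, by rw [mk_toWord, mul_inv_cancel_left]⟩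
    obtain ⟨q, hq, rfl⟩ := hy y
    obtain ⟨q', hq', rfl⟩ := hy z
    set n := max q.length q'.length with hn
    have key : ∀ w, FreeGroup.IsReduced w → P n <+: w →
        (wordDist (genSet φ) (φ (c 0 * mk w)) (φ (c 0 * mk q)) : ℝ) -
          wordDist (genSet φ) (φ (c 0 * mk w)) (φ (c 0 * mk q')) =
        (q.length - 2 * lcpLen (P n) q) - (q'.length - 2 * lcpLen (P n) q') := by
      rintro w hw ⟨r, rfl⟩
      have h1 := hdist _ q hw hq
      have h2 := hdist _ q' hw hq'
      rw [lcpLen_append_left _ _ _ (by rw [hPl]; exact le_max_left _ _)] at h1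
      rw [lcpLen_append_left _ _ _ (by rw [hPl]; exact le_max_right _ _)] at h2
      have h1' := congrArg (Nat.cast : ℕ → ℝ) h1
      have h2' := congrArg (Nat.cast : ℕ → ℝ) h2
      push_cast at h1' h2'
      linarith
    refine ⟨(q.length - 2 * lcpLen (P n) q) - (q'.length - 2 * lcpLen (P n) q'),
      tendsto_const_nhds.congr' ?_, tendsto_const_nhds.congr' ?_⟩
    · filter_upwards [hPe n] with t ht
      rw [hγW t]
      exact (key _ (hWr t) ht).symm
    · refine Filter.Eventually.filter_mono inf_le_left ?_
      filter_upwards [eventually_ge_atTop (n : ℝ)] with t ht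
      exact (key _ (hPr _) (hPP _ _ (Nat.le_floor ht))).symm

end helpers

/-- Let `φ : F_k → G` be surjective with kernel `N`, and suppose `N` is
generated by a set `R` of elements of reduced word length at most `M`. Then, in the word
metric on `G` from the images of the free generators and their inverses, every rigid
triple has perimeter at most `3M/2`; consequently every point of the metric boundary of
the Cayley graph is a Busemann point. -/
theorem stmt9 {k : ℕ} {G : Type*} [Group G]
    (φ : FreeGroup (Fin k) →* G) (hsurj : Function.Surjective φ)
    (M : ℕ) (R : Set (FreeGroup (Fin k)))
    (hR : Subgroup.closure R = φ.ker)
    (hRM : ∀ r ∈ R, (FreeGroup.toWord r).length ≤ M) :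
    (∀ x y z : G, RigidTriple (wordDist (genSet φ)) x y z →
      ((wordDist (genSet φ) x y + wordDist (genSet φ) y z
        + wordDist (genSet φ) z x : ℕ) : ℝ) ≤ 3 * M / 2) ∧
    (∀ (T : Set ℝ) (γ : ℝ → G), IsRayDomain T →
      WeaklyGeodesicRay (fun g h => (wordDist (genSet φ) g h : ℝ)) T γ →
      ∃ (T' : Set ℝ) (γ' : ℝ → G), IsRayDomain T' ∧
        GeodesicRay (fun g h => (wordDist (genSet φ) g h : ℝ)) T' γ' ∧
        ∀ y z : G, ∃ L : ℝ,
          RayLimit (fun g h => (wordDist (genSet φ) g h : ℝ)) T γ y z L ∧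
          RayLimit (fun g h => (wordDist (genSet φ) g h : ℝ)) T' γ' y z L) := by
  by_cases hN : ∃ r, r ≠ 1 ∧ φ r = 1
  · obtain ⟨r, hr, hr1⟩ := hN
    have hd := diam_bound φ hsurj M R hR hRM r hr hr1
    constructor
    · intro x y z _
      have h1 := hd x y
      have h2 := hd y z
      have h3 := hd z x
      have h4 : 2 * (wordDist (genSet φ) x y + wordDist (genSet φ) y z
        + wordDist (genSet φ) z x) ≤ 3 * M := by omega
      have h5 : (2 : ℝ) * ((wordDist (genSet φ) x y + wordDist (genSet φ) y z
        + wordDist (genSet φ) z x : ℕ) : ℝ) ≤ 3 * M := by exact_mod_cast h4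
      linarith
    · intro T γ hT hγ
      exfalso
      obtain ⟨N, hN⟩ := hγ (γ 0) 1 one_pos
      obtain ⟨t, ht, hlt⟩ := hT.2.2 (max N (M + 1))
      have h1 := (hN t ht t ht ((le_max_left _ _).trans hlt.le)
        ((le_max_left _ _).trans hlt.le)).1
      have h2 : (M : ℝ) + 1 < t := (le_max_right _ _).trans_lt hlt
      have h3 : (2 : ℝ) * wordDist (genSet φ) (γ t) (γ 0) ≤ M := by
        exact_mod_cast hd (γ t) (γ 0)
      have h4 : (0 : ℝ) ≤ wordDist (genSet φ) (γ t) (γ 0) := Nat.cast_nonneg _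
      rw [abs_lt] at h1
      linarith [h1.1]
  · have hinj : Function.Injective φ := by
      rw [injective_iff_map_eq_one]
      intro a ha
      by_contra h
      exact hN ⟨a, h, ha⟩
    exact ⟨fun x y z h => absurd h (no_rigid_free φ hsurj hinj x y z),
      fun T γ hT hγ => busemann_free φ hsurj hinj T γ hT hγ⟩
end

section
/- Let G = ℤ/2 * ℤ/3 be the free product of the cyclic groups of orders 2 and 3, with a the generator of the ℤ/2 factor and b a generator of the ℤ/3 factor, and let d be the word metric on G with respect to the symmetric generating set S = {a, b, b⁻¹}. Then every rigid triple in (G,d) has perimeter at most 3; consequently every weakly-geodesic ray in (G,d) admits a geodesic ray with the same limits lim (d(γ(t),y) − d(γ(t),z)) for all y, z ∈ G, i.e. every point of the metric boundary of this Cayley graph is a Busemann point. -/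
open Filter Topology

/-- The free product `ℤ/2 * ℤ/3`. -/
abbrev Z2Z3 := Monoid.Coprod (Multiplicative (ZMod 2)) (Multiplicative (ZMod 3))

/-- The generator `a` of the `ℤ/2` factor. -/
def genA : Z2Z3 := Monoid.Coprod.inl (Multiplicative.ofAdd (1 : ZMod 2))

/-- The generator `b` of the `ℤ/3` factor. -/
def genB : Z2Z3 := Monoid.Coprod.inr (Multiplicative.ofAdd (1 : ZMod 3))


namespace ZZ

/-- letters: `none` is `a`, `some true` is `b`, `some false` is `b⁻¹` -/
abbrev Ltr := Option Bool

def Red (l : List Ltr) : Prop := l.IsChain (fun x y => x.isSome ≠ y.isSome)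

abbrev W := {l : List Ltr // Red l}

def rA : List Ltr → List Ltr
  | none :: l => l
  | l => none :: l

def rB : List Ltr → List Ltr
  | some true :: l => some false :: l
  | some false :: l => l
  | l => some true :: l

def rC : List Ltr → List Ltr
  | some false :: l => some true :: l
  | some true :: l => l
  | l => some false :: l

lemma red_rA {l} (h : Red l) : Red (rA l) := by
  rcases l with _ | ⟨_ | _ | _, _ | ⟨_ | _ | _, l⟩⟩ <;> simp_all [Red, rA]
lemma red_rB {l} (h : Red l) : Red (rB l) := by
  rcases l with _ | ⟨_ | _ | _, _ | ⟨_ | _ | _, l⟩⟩ <;> simp_all [Red, rB]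
lemma red_rC {l} (h : Red l) : Red (rC l) := by
  rcases l with _ | ⟨_ | _ | _, _ | ⟨_ | _ | _, l⟩⟩ <;> simp_all [Red, rC]
lemma rArA {l} (h : Red l) : rA (rA l) = l := by
  rcases l with _ | ⟨_ | _ | _, _ | ⟨_ | _ | _, l⟩⟩ <;> simp_all [Red, rA]
lemma rBrC {l} (h : Red l) : rB (rC l) = l := by
  rcases l with _ | ⟨_ | _ | _, _ | ⟨_ | _ | _, l⟩⟩ <;> simp_all [Red, rB, rC]
lemma rCrB {l} (h : Red l) : rC (rB l) = l := by
  rcases l with _ | ⟨_ | _ | _, _ | ⟨_ | _ | _, l⟩⟩ <;> simp_all [Red, rB, rC]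
lemma rBrB {l} (h : Red l) : rB (rB l) = rC l := by
  rcases l with _ | ⟨_ | _ | _, _ | ⟨_ | _ | _, l⟩⟩ <;> simp_all [Red, rB, rC]

def pA : Equiv.Perm W where
  toFun w := ⟨rA w.1, red_rA w.2⟩
  invFun w := ⟨rA w.1, red_rA w.2⟩
  left_inv w := Subtype.ext (rArA w.2)
  right_inv w := Subtype.ext (rArA w.2)

def pB : Equiv.Perm W where
  toFun w := ⟨rB w.1, red_rB w.2⟩
  invFun w := ⟨rC w.1, red_rC w.2⟩
  left_inv w := Subtype.ext (rCrB w.2)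
  right_inv w := Subtype.ext (rBrC w.2)

lemma pA2 : pA ^ 2 = 1 := by
  ext1 w; exact Subtype.ext (rArA w.2)

lemma pB3 : pB ^ 3 = 1 := by
  ext1 w
  apply Subtype.ext
  change rB (rB (rB w.1)) = w.1
  rw [rBrB w.2, rBrC w.2]

def cyc {G : Type*} [Group G] (n : ℕ) [NeZero n] (g : G) (h : g ^ n = 1) :
    Multiplicative (ZMod n) →* G where
  toFun m := g ^ (Multiplicative.toAdd m).val
  map_one' := by simp
  map_mul' x y := by
    rw [toAdd_mul, ZMod.val_add, ← pow_add, ← pow_eq_pow_mod _ h]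

def phi : Z2Z3 →* Equiv.Perm W :=
  Monoid.Coprod.lift (cyc 2 pA pA2) (cyc 3 pB pB3)

lemma phi_a : phi genA = pA := by
  simp [phi, genA, cyc, ZMod.val_one]
lemma phi_b : phi genB = pB := by
  have : (1 : ZMod 3).val = 1 := rfl
  simp [phi, genB, cyc, this]

lemma aa : genA * genA = 1 := by
  rw [genA, ← map_mul, ← map_one Monoid.Coprod.inl]; congr 1
lemma bbb : genB * genB * genB = 1 := by
  rw [genB, ← map_mul, ← map_mul, ← map_one Monoid.Coprod.inr]; congr 1
lemma ainv : genA⁻¹ = genA := by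
  rw [inv_eq_iff_mul_eq_one, aa]
lemma bb : genB * genB = genB⁻¹ := by
  rw [eq_inv_iff_mul_eq_one, bbb]

lemma gen_induction {p : Z2Z3 → Prop} (h1 : p 1) (ha : ∀ g, p g → p (g * genA))
    (hb : ∀ g, p g → p (g * genB)) (g : Z2Z3) : p g := by
  suffices h : ∀ g x, p x → p (x * g) by simpa using h g 1 h1
  intro g
  induction g using Monoid.Coprod.induction_on with
  | inl m =>
    intro x hx
    have : m = 1 ∨ m = Multiplicative.ofAdd (1 : ZMod 2) := by
      revert m; decide
    rcases this with rfl | rfl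
    · simpa using hx
    · exact ha _ hx
  | inr m =>
    intro x hx
    have : m = 1 ∨ m = Multiplicative.ofAdd (1 : ZMod 3) ∨
      m = Multiplicative.ofAdd (1 : ZMod 3) * Multiplicative.ofAdd (1 : ZMod 3) := by
      revert m; decide
    rcases this with rfl | rfl | rfl
    · simpa using hx
    · exact hb _ hx
    · rw [map_mul, ← mul_assoc]
      exact hb _ (hb _ hx)
  | mul g h ihg ihh =>
    intro x hx
    rw [← mul_assoc]
    exact ihh _ (ihg _ hx)

def evl : Ltr → Z2Z3
  | none => genA
  | some true => genB
  | some false => genB⁻¹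

def ev (l : List Ltr) : Z2Z3 := (l.map evl).prod

lemma ev_rA (l) : ev (rA l) = genA * ev l := by
  rcases l with _ | ⟨_ | _ | _, l⟩ <;> simp [ev, evl, rA, ← mul_assoc, aa]
lemma ev_rB (l) : ev (rB l) = genB * ev l := by
  rcases l with _ | ⟨_ | _ | _, l⟩ <;> simp [ev, evl, rB, ← mul_assoc, bb]

lemma ev_phi (g : Z2Z3) : ∀ w : W, ev (phi g w).1 = g * ev w.1 := by
  induction g using gen_induction with
  | h1 => simp
  | ha g ih =>
    intro w
    rw [map_mul, Equiv.Perm.mul_apply, ih, phi_a, mul_assoc]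
    congr 1; exact ev_rA _
  | hb g ih =>
    intro w
    rw [map_mul, Equiv.Perm.mul_apply, ih, phi_b, mul_assoc]
    congr 1; exact ev_rB _

def w0 : W := ⟨[], by simp [Red]⟩

def M (g : Z2Z3) : ℕ := (phi g⁻¹ w0).1.length

lemma M_one : M 1 = 0 := by simp [M, w0]

/-- the local structure of a length function -/
lemma M_table (g : Z2Z3) :
    (g = 1 ∧ M g = 0 ∧ M (g * genA) = 1 ∧ M (g * genB) = 1 ∧ M (g * genB⁻¹) = 1) ∨
    (M (g * genA) + 1 = M g ∧ M (g * genB) = M g + 1 ∧ M (g * genB⁻¹) = M g + 1) ∨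
    (M (g * genA) = M g + 1 ∧ M (g * genB) + 1 = M g ∧ M (g * genB⁻¹) = M g) ∨
    (M (g * genA) = M g + 1 ∧ M (g * genB) = M g ∧ M (g * genB⁻¹) + 1 = M g) := by
  have hA : M (g * genA) = (rA (phi g⁻¹ w0).1).length := by
    rw [M, mul_inv_rev, ainv, map_mul, phi_a]; rfl
  have hB : M (g * genB) = (rC (phi g⁻¹ w0).1).length := by
    rw [M, mul_inv_rev, map_mul, map_inv, phi_b]; rfl
  have hC : M (g * genB⁻¹) = (rB (phi g⁻¹ w0).1).length := by
    rw [M, mul_inv_rev, inv_inv, map_mul, phi_b]; rfl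
  have hM : M g = (phi g⁻¹ w0).1.length := rfl
  have he := ev_phi g⁻¹ w0
  have he0 : ev w0.1 = 1 := rfl
  rw [hA, hB, hC, hM]
  rw [he0, mul_one] at he
  generalize (phi g⁻¹ w0).1 = l at *
  rcases l with _ | ⟨_ | _ | _, l⟩
  · left
    have : g⁻¹ = 1 := he.symm
    simpa [rA, rB, rC] using this
  all_goals simp [rA, rB, rC]

abbrev SS : Set Z2Z3 := {genA, genB, genB⁻¹}

lemma exists_list (n : ℕ) : ∀ g : Z2Z3, M g = n →
    ∃ l : List Z2Z3, l.length = n ∧ (∀ x ∈ l, x ∈ SS) ∧ l.prod = g := by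
  induction n with
  | zero =>
    intro g hg
    refine ⟨[], rfl, by simp, ?_⟩
    rcases M_table g with h | h | h | h
    · exact h.1.symm
    all_goals omega
  | succ n ih =>
    intro g hg
    have : ∃ s ∈ SS, s⁻¹ ∈ SS ∧ M (g * s) = n := by
      rcases M_table g with h | h | h | h
      · omega
      · exact ⟨genA, by simp, by simp [ainv], by omega⟩
      · exact ⟨genB, by simp, by simp, by omega⟩
      · exact ⟨genB⁻¹, by simp, by simp, by omega⟩
    obtain ⟨s, -, hs, h⟩ := this
    obtain ⟨l, hl, hl', hp⟩ := ih _ h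
    refine ⟨l ++ [s⁻¹], by simp [hl], ?_, by simp [hp]⟩
    intro x hx
    rcases List.mem_append.1 hx with hx | hx
    · exact hl' x hx
    · rw [List.mem_singleton.1 hx]; exact hs

lemma M_mul_le (l : List Z2Z3) : (∀ x ∈ l, x ∈ SS) → ∀ g, M (g * l.prod) ≤ M g + l.length := by
  induction l with
  | nil => simp
  | cons s l ih =>
    intro h g
    have h1 := ih (fun x hx => h x (List.mem_cons_of_mem _ hx)) (g * s)
    have h2 : M (g * s) ≤ M g + 1 := by
      have hs : s = genA ∨ s = genB ∨ s = genB⁻¹ := h s List.mem_cons_self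
      rcases hs with rfl | rfl | rfl <;> rcases M_table g with h | h | h | h <;> omega
    rw [List.prod_cons, ← mul_assoc, List.length_cons]
    omega

lemma wd (x y : Z2Z3) : wordDist SS x y = M (x⁻¹ * y) := by
  obtain ⟨l, h1, h2, h3⟩ := exists_list _ (x⁻¹ * y) rfl
  apply le_antisymm
  · exact Nat.sInf_le ⟨l, h1, h2, h3⟩
  · refine le_csInf ⟨_, l, h1, h2, h3⟩ ?_
    rintro n ⟨l', rfl, h5, h6⟩
    have := M_mul_le l' h5 1
    rw [one_mul, M_one, h6] at this
    omega

noncomputable def D (x y : Z2Z3) : ℕ := wordDist SS x y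

lemma D_tri (x y z : Z2Z3) : D x z ≤ D x y + D y z := by
  obtain ⟨l, h1, h2, h3⟩ := exists_list _ (y⁻¹ * z) rfl
  have := M_mul_le l h2 (x⁻¹ * y)
  rw [h3, h1] at this
  simp only [D, wd]
  convert this using 2
  group

lemma M_inv_le (g : Z2Z3) : M g⁻¹ ≤ M g := by
  obtain ⟨l, h1, h2, h3⟩ := exists_list _ g rfl
  have := M_mul_le (l.map (·⁻¹)).reverse (by
    intro x hx
    simp only [List.mem_reverse, List.mem_map] at hx
    obtain ⟨y, hy, rfl⟩ := hx
    have hs : y = genA ∨ y = genB ∨ y = genB⁻¹ := h2 y hy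
    rcases hs with rfl | rfl | rfl <;> simp [ainv]) 1
  rw [← List.prod_inv_reverse, h3] at this
  simpa [M_one, h1] using this

lemma D_comm (x y : Z2Z3) : D x y = D y x := by
  simp only [D, wd]
  have h1 := M_inv_le (x⁻¹ * y)
  have h2 := M_inv_le (y⁻¹ * x)
  simp only [mul_inv_rev, inv_inv] at h1 h2
  omega

lemma D_table (y x : Z2Z3) :
    (y = x ∧ D y x = 0 ∧ D y (x * genA) = 1 ∧ D y (x * genB) = 1 ∧ D y (x * genB⁻¹) = 1) ∨
    (D y (x * genA) + 1 = D y x ∧ D y (x * genB) = D y x + 1 ∧ D y (x * genB⁻¹) = D y x + 1) ∨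
    (D y (x * genA) = D y x + 1 ∧ D y (x * genB) + 1 = D y x ∧ D y (x * genB⁻¹) = D y x) ∨
    (D y (x * genA) = D y x + 1 ∧ D y (x * genB) = D y x ∧ D y (x * genB⁻¹) + 1 = D y x) := by
  have h := M_table (y⁻¹ * x)
  simp only [D, wd]
  rw [inv_mul_eq_one] at h
  simpa only [mul_assoc] using h

lemma D_self (x : Z2Z3) : D x x = 0 := by
  simp [D, wd, M_one]

lemma D_gen (x : Z2Z3) : D x (x * genA) = 1 ∧ D x (x * genB) = 1 ∧ D x (x * genB⁻¹) = 1 := by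
  have := D_self x
  rcases D_table x x with h | h | h | h
  · exact h.2.2
  all_goals omega

lemma xaa (x : Z2Z3) : x * genA * genA = x := by rw [mul_assoc, aa, mul_one]
lemma xbb (x : Z2Z3) : x * genB * genB = x * genB⁻¹ := by rw [mul_assoc, bb]
lemma xcc (x : Z2Z3) : x * genB⁻¹ * genB⁻¹ = x * genB := by
  rw [← bb]; simp only [← mul_assoc]; rw [mul_assoc x, mul_assoc x, bbb, mul_one]

/-- concatenation of geodesics leaving `x` through different blocks -/
lemma concat (y z : Z2Z3) (n : ℕ) : ∀ x, D z x = n →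
    ((D y (x * genA) + 1 = D y x ∧ D z x < D z (x * genA)) ∨
     (D y x < D y (x * genA) ∧ y ≠ x ∧ D z x < D z (x * genB) ∧ D z x < D z (x * genB⁻¹))) →
    D y z = D y x + D x z := by
  induction n with
  | zero =>
    intro x hx _
    rcases D_table z x with h | h | h | h
    · rw [h.1, D_self, add_zero]
    all_goals omega
  | succ n ih =>
    intro x hx hyp
    have cz := D_comm x z
    have hy := D_table y x
    rcases D_table z x with h | h | h | h
    · omega
    · have cA := D_comm (x * genA) z
      have iA := ih (x * genA) (by omega)
      rw [xaa] at iA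
      have := iA (Or.inl (by omega))
      omega
    · have cB := D_comm (x * genB) z
      have iB := ih (x * genB) (by omega)
      rw [xbb, mul_inv_cancel_right] at iB
      have e1 : D y (x * genB) = D y x + 1 := by omega
      have e2 : D y (x * genB) < D y (x * genB * genA) := by
        have hB := D_table y (x * genB)
        rw [xbb, mul_inv_cancel_right] at hB
        omega
      have hne : y ≠ x * genB := fun hh => by
        rw [← hh, D_self] at e1; omega
      have := iB (Or.inr ⟨e2, hne, by omega, by omega⟩)
      omega
    · have cC := D_comm (x * genB⁻¹) z
      have iC := ih (x * genB⁻¹) (by omega)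
      rw [xcc, inv_mul_cancel_right] at iC
      have e1 : D y (x * genB⁻¹) = D y x + 1 := by omega
      have e2 : D y (x * genB⁻¹) < D y (x * genB⁻¹ * genA) := by
        have hC := D_table y (x * genB⁻¹)
        rw [xcc, inv_mul_cancel_right] at hC
        omega
      have hne : y ≠ x * genB⁻¹ := fun hh => by
        rw [← hh, D_self] at e1; omega
      have := iC (Or.inr ⟨e2, hne, by omega, by omega⟩)
      omega

lemma tri_case (x y z s : Z2Z3) (hs : x * s ≠ x)
    (h : RigidApex D x y z) (h1 : D x (x * s) = 1)
    (hy : D y (x * s) + 1 = D y x) (hz : D z (x * s) + 1 = D z x) : False := by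
  refine h (x * s) hs ⟨?_, ?_⟩
  · rw [D_comm _ y, D_comm x y]; omega
  · rw [D_comm _ z, D_comm x z]; omega

lemma rigid_bc (x y z : Z2Z3) (hxy : x ≠ y)
    (h2 : RigidApex D y x z)
    (a1 : D y (x * genA) = D y x + 1) (a2 : D y (x * genB) + 1 = D y x)
    (a3 : D y (x * genB⁻¹) = D y x)
    (b2 : D z (x * genB) = D z x)
    (b3 : D z (x * genB⁻¹) + 1 = D z x) : y = x * genB := by
  by_contra hne
  have hu := D_table y (x * genB)
  have hv := D_table z (x * genB)
  rw [xbb, mul_inv_cancel_right] at hu hv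
  have hu := hu.resolve_left fun hh => hne hh.1
  have hc := concat y z _ (x * genB) rfl (Or.inl ⟨by omega, by omega⟩)
  refine h2 (x * genB) (Ne.symm hne) ⟨?_, hc.symm⟩
  have := (D_gen x).2.1
  have := D_comm x (x * genB)
  omega

lemma rigid_cb (x y z : Z2Z3) (hxy : x ≠ y)
    (h2 : RigidApex D y x z)
    (a1 : D y (x * genA) = D y x + 1) (a2 : D y (x * genB⁻¹) + 1 = D y x)
    (a3 : D y (x * genB) = D y x)
    (b2 : D z (x * genB⁻¹) = D z x)
    (b3 : D z (x * genB) + 1 = D z x) : y = x * genB⁻¹ := by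
  by_contra hne
  have hu := D_table y (x * genB⁻¹)
  have hv := D_table z (x * genB⁻¹)
  rw [xcc, inv_mul_cancel_right] at hu hv
  have hu := hu.resolve_left fun hh => hne hh.1
  have hc := concat y z _ (x * genB⁻¹) rfl (Or.inl ⟨by omega, by omega⟩)
  refine h2 (x * genB⁻¹) (Ne.symm hne) ⟨?_, hc.symm⟩
  have := (D_gen x).2.2
  have := D_comm x (x * genB⁻¹)
  omega

lemma ne_of_D {x y : Z2Z3} (h : D x y = 1) : y ≠ x := by
  rintro rfl; rw [D_self] at h; omega

lemma rigid (x y z : Z2Z3) (h : RigidTriple D x y z) : D x y + D y z + D z x ≤ 3 := by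
  obtain ⟨hxy, hyz, hxz, h1, h2, h3⟩ := h
  have g := D_gen x
  have noc : D y z ≠ D y x + D x z := fun hc =>
    h2 x hxy ⟨by rw [D_self, add_zero], hc.symm⟩
  rcases D_table y x with p | p | p | p
  · exact absurd p.1.symm hxy
  · rcases D_table z x with q | q | q | q
    · exact absurd q.1.symm hxz
    · exact (tri_case x y z _ (ne_of_D g.1) h1 g.1 p.1 q.1).elim
    · exact (noc (concat y z _ x rfl (Or.inl ⟨by omega, by omega⟩))).elim
    · exact (noc (concat y z _ x rfl (Or.inl ⟨by omega, by omega⟩))).elim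
  · rcases D_table z x with q | q | q | q
    · exact absurd q.1.symm hxz
    · exact (noc (concat y z _ x rfl (Or.inr ⟨by omega, hxy.symm, by omega, by omega⟩))).elim
    · exact (tri_case x y z _ (ne_of_D g.2.1) h1 g.2.1 p.2.1 q.2.1).elim
    · have e1 := rigid_bc x y z hxy h2 p.1 p.2.1 p.2.2 q.2.1 q.2.2
      have e2 := rigid_cb x z y hxz h3 q.1 q.2.2 q.2.1 p.2.2 p.2.1
      have c1 := D_comm y z
      have c2 := D_comm x z
      have q1 := q.2.1
      rw [← e1, ← e2] at g
      rw [← e1] at q1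
      omega
  · rcases D_table z x with q | q | q | q
    · exact absurd q.1.symm hxz
    · exact (noc (concat y z _ x rfl (Or.inr ⟨by omega, hxy.symm, by omega, by omega⟩))).elim
    · have e1 := rigid_cb x y z hxy h2 p.1 p.2.2 p.2.1 q.2.2 q.2.1
      have e2 := rigid_bc x z y hxz h3 q.1 q.2.1 q.2.2 p.2.1 p.2.2
      have c1 := D_comm y z
      have c2 := D_comm x z
      have q1 := q.2.2
      rw [← e1, ← e2] at g
      rw [← e1] at q1
      omega
    · exact (tri_case x y z _ (ne_of_D g.2.2) h1 g.2.2 p.2.2 q.2.2).elim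

/-- Gradient rays of a horofunction. -/
lemma horo (f : Z2Z3 → ℤ) (x0 : Z2Z3) (lip : ∀ x y, f x - f y ≤ D y x)
    (tab : ∀ x,
      (f (x * genA) = f x - 1 ∧ f (x * genB) = f x + 1 ∧ f (x * genB⁻¹) = f x + 1) ∨
      (f (x * genA) = f x + 1 ∧ f (x * genB) = f x - 1 ∧ f (x * genB⁻¹) = f x) ∨
      (f (x * genA) = f x + 1 ∧ f (x * genB) = f x ∧ f (x * genB⁻¹) = f x - 1)) :
    ∃ u : ℕ → Z2Z3, (∀ m n, (D (u m) (u n) : ℤ) = |(m : ℤ) - n|) ∧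
      ∀ y, ∀ᶠ n in atTop, (D (u n) y : ℤ) = f y - f x0 + n := by
  have step : ∀ x, ∃ x', D x x' = 1 ∧ f x' = f x - 1 := by
    intro x
    have g := D_gen x
    rcases tab x with h | h | h
    · exact ⟨_, g.1, h.1⟩
    · exact ⟨_, g.2.1, h.2.1⟩
    · exact ⟨_, g.2.2, h.2.2⟩
  choose nx hn1 hn2 using step
  set u : ℕ → Z2Z3 := fun n => nx^[n] x0 with hu
  have us : ∀ n, u (n + 1) = nx (u n) := fun n => Function.iterate_succ_apply' nx n x0
  have fu : ∀ n, f (u n) = f x0 - n := by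
    intro n
    induction n with
    | zero => simp [hu]
    | succ n ih => rw [us, hn2, ih]; push_cast; ring
  have up : ∀ m k, D (u m) (u (m + k)) ≤ k := by
    intro m k
    induction k with
    | zero => simp [D_self]
    | succ k ih =>
      have := D_tri (u m) (u (m + k)) (u (m + k + 1))
      rw [us (m + k), hn1] at this
      rw [← add_assoc, us (m + k)]
      omega
  have eqk : ∀ m k, D (u m) (u (m + k)) = k := by
    intro m k
    have h1 := up m k
    have h2 := lip (u m) (u (m + k))
    rw [fu, fu, D_comm] at h2
    push_cast at h2
    omega
  refine ⟨u, ?_, ?_⟩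
  · intro m n
    rcases le_total m n with h | h
    · obtain ⟨k, rfl⟩ := Nat.exists_eq_add_of_le h
      rw [eqk]; push_cast
      rw [abs_of_nonpos] <;> omega
    · obtain ⟨k, rfl⟩ := Nat.exists_eq_add_of_le h
      rw [D_comm, eqk]; push_cast
      rw [abs_of_nonneg] <;> omega
  · have key : ∀ y, (∀ᶠ n in atTop, (D (u n) y : ℤ) = f y - f x0 + n) →
        (∀ᶠ n in atTop, (D (u n) (y * genA) : ℤ) = f (y * genA) - f x0 + n) ∧
        (∀ᶠ n in atTop, (D (u n) (y * genB) : ℤ) = f (y * genB) - f x0 + n) := by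
      intro y hy
      rw [← eventually_and]
      filter_upwards [hy, eventually_gt_atTop (f x0 - f y).toNat] with n h1 h2
      have l1 := lip (y * genA) (u n)
      have l2 := lip (y * genB) (u n)
      have l3 := lip (y * genB⁻¹) (u n)
      rw [fu] at l1 l2 l3
      have t := tab y
      rcases D_table (u n) y with h | h | h | h <;> omega
    have main : ∀ g, ∀ᶠ n in atTop, (D (u n) (x0 * g) : ℤ) = f (x0 * g) - f x0 + n := by
      intro g
      induction g using gen_induction with
      | h1 =>
        refine Eventually.of_forall fun n => ?_
        have := eqk 0 n
        rw [zero_add, D_comm] at this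
        simpa [hu] using this
      | ha g ih => rw [← mul_assoc]; exact (key _ ih).1
      | hb g ih => rw [← mul_assoc]; exact (key _ ih).2
    intro y
    simpa using main (x0⁻¹ * y)

lemma part2 (T : Set ℝ) (γ : ℝ → Z2Z3) (hT : IsRayDomain T)
    (hw : WeaklyGeodesicRay (fun g h => (D g h : ℝ)) T γ) :
    ∃ (T' : Set ℝ) (γ' : ℝ → Z2Z3), IsRayDomain T' ∧
      GeodesicRay (fun g h => (D g h : ℝ)) T' γ' ∧
      ∀ y z : Z2Z3, ∃ L : ℝ,
        RayLimit (fun g h => (D g h : ℝ)) T γ y z L ∧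
        RayLimit (fun g h => (D g h : ℝ)) T' γ' y z L := by
  set F : Filter ℝ := atTop ⊓ 𝓟 T with hF
  have evF : ∀ (p : ℝ → Prop) (N : ℝ), (∀ t ∈ T, N ≤ t → p t) → ∀ᶠ t in F, p t := by
    intro p N h
    rw [hF, eventually_inf_principal]
    filter_upwards [eventually_ge_atTop N] with t ht htT using h t htT ht
  have hne : F.NeBot := by
    rw [hF, ← frequently_mem_iff_neBot, frequently_atTop]
    intro M
    obtain ⟨t, ht, h⟩ := hT.2.2 M
    exact ⟨t, h.le, ht⟩
  have exf : ∀ y, ∃ c : ℤ, ∀ᶠ t in F, (D (γ t) y : ℤ) - D (γ t) (γ 0) = c := by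
    intro y
    obtain ⟨N1, h1⟩ := hw y (1/2) (by norm_num)
    obtain ⟨N2, h2⟩ := hw (γ 0) (1/2) (by norm_num)
    obtain ⟨s, hs, hsN⟩ := hT.2.2 (max N1 N2)
    refine ⟨(D (γ s) y : ℤ) - D (γ s) (γ 0), evF _ (max N1 N2) fun t ht htN => ?_⟩
    have a1 := (h1 s hs t ht ((le_max_left _ _).trans hsN.le) ((le_max_left _ _).trans htN)).2
    have a2 := (h2 s hs t ht ((le_max_right _ _).trans hsN.le) ((le_max_right _ _).trans htN)).2
    rw [abs_lt] at a1 a2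
    have b1 : (((D (γ t) y : ℤ) - D (γ t) (γ 0) : ℤ) : ℝ) <
        (((D (γ s) y : ℤ) - D (γ s) (γ 0) + 1 : ℤ) : ℝ) := by push_cast; linarith
    have b2 : (((D (γ s) y : ℤ) - D (γ s) (γ 0) : ℤ) : ℝ) <
        (((D (γ t) y : ℤ) - D (γ t) (γ 0) + 1 : ℤ) : ℝ) := by push_cast; linarith
    rw [Int.cast_lt] at b1 b2
    omega
  choose f hf using exf
  have far : ∀ x, ∀ᶠ t in F, 0 < D (γ t) x := by
    intro x
    obtain ⟨N, h⟩ := hw x 1 one_pos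
    refine evF _ (max N (D x (γ 0) + 1)) fun t ht htN => ?_
    have a := (h t ht t ht ((le_max_left _ _).trans htN) ((le_max_left _ _).trans htN)).1
    have b := (le_max_right _ _).trans htN
    rw [abs_lt] at a
    by_contra hc
    have h0 : D (γ t) x = 0 := by omega
    have := D_tri (γ t) x (γ 0)
    rw [h0, zero_add] at this
    have : (D (γ t) (γ 0) : ℝ) ≤ D x (γ 0) := by exact_mod_cast this
    linarith
  have lip : ∀ x y, f x - f y ≤ D y x := by
    intro x y
    obtain ⟨t, h1, h2⟩ := ((hf x).and (hf y)).exists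
    have := D_tri (γ t) y x
    omega
  obtain ⟨u, hu1, hu2⟩ := horo f (γ 0) lip (by
    intro x
    obtain ⟨t, h1, h2, h3, h4, h5⟩ := ((hf x).and ((hf (x * genA)).and ((hf (x * genB)).and
      ((hf (x * genB⁻¹)).and (far x))))).exists
    rcases D_table (γ t) x with h | h | h | h <;> omega)
  refine ⟨Set.range (Nat.cast : ℕ → ℝ), fun r => u ⌊r⌋₊, ⟨?_, ⟨0, by simp⟩, ?_⟩, ?_, ?_⟩
  · rintro _ ⟨n, rfl⟩; exact Set.mem_Ici.2 (Nat.cast_nonneg (α := ℝ) n)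
  · intro M
    obtain ⟨n, hn⟩ := exists_nat_gt M
    exact ⟨n, ⟨n, rfl⟩, hn⟩
  · rintro _ ⟨m, rfl⟩ _ ⟨n, rfl⟩
    simp only [Nat.floor_natCast]
    exact_mod_cast hu1 m n
  · intro y z
    refine ⟨((f y - f z : ℤ) : ℝ), ?_, ?_⟩
    · refine tendsto_const_nhds.congr' ?_
      filter_upwards [hf y, hf z] with t h1 h2
      have : f y - f z = (D (γ t) y : ℤ) - D (γ t) z := by omega
      rw [this]; push_cast; rfl
    · refine tendsto_const_nhds.congr' ?_
      have hN := (hu2 y).and (hu2 z)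
      obtain ⟨N, hN⟩ := eventually_atTop.1 hN
      rw [EventuallyEq, eventually_inf_principal]
      filter_upwards [eventually_ge_atTop (N : ℝ)] with t ht
      rintro ⟨n, rfl⟩
      obtain ⟨h1, h2⟩ := hN n (by exact_mod_cast ht)
      simp only [Nat.floor_natCast]
      have : f y - f z = (D (u n) y : ℤ) - D (u n) z := by omega
      rw [this]; push_cast; rfl

end ZZ

/-- In `G = ℤ/2 * ℤ/3` with the word metric for `S = {a, b, b⁻¹}`, every
rigid triple has perimeter at most `3`; consequently every point of the metric boundary
of this Cayley graph is a Busemann point. -/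
theorem stmt15 :
    (∀ x y z : Z2Z3, RigidTriple (wordDist {genA, genB, genB⁻¹}) x y z →
      wordDist {genA, genB, genB⁻¹} x y + wordDist {genA, genB, genB⁻¹} y z
        + wordDist {genA, genB, genB⁻¹} z x ≤ 3) ∧
    (∀ (T : Set ℝ) (γ : ℝ → Z2Z3), IsRayDomain T →
      WeaklyGeodesicRay (fun g h => (wordDist {genA, genB, genB⁻¹} g h : ℝ)) T γ →
      ∃ (T' : Set ℝ) (γ' : ℝ → Z2Z3), IsRayDomain T' ∧
        GeodesicRay (fun g h => (wordDist {genA, genB, genB⁻¹} g h : ℝ)) T' γ' ∧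
        ∀ y z : Z2Z3, ∃ L : ℝ,
          RayLimit (fun g h => (wordDist {genA, genB, genB⁻¹} g h : ℝ)) T γ y z L ∧
          RayLimit (fun g h => (wordDist {genA, genB, genB⁻¹} g h : ℝ)) T' γ' y z L) := by
  exact ⟨fun x y z h => ZZ.rigid x y z h, fun T γ hT hw => ZZ.part2 T γ hT hw⟩
end

section
/- Let G be the group presented by four generators a, b, c, d and the single relation a·b·a⁻¹·d·c·d⁻¹ = 1 (so that a·b·a⁻¹ = d·c⁻¹·d⁻¹), and let ρ be the word metric on G with respect to the symmetric generating set S = {a, b, c, d, a⁻¹, b⁻¹, c⁻¹, d⁻¹}. Then there exists a weakly-geodesic ray γ : T → G such that for every geodesic ray γ' : T' → G there exist y, z ∈ G with lim_{t→∞, t∈T} (ρ(γ(t),y) − ρ(γ(t),z)) ≠ lim_{t→∞, t∈T'} (ρ(γ'(t),y) − ρ(γ'(t),z)); that is, the metric boundary of this Cayley graph contains a point which is not a Busemann point. -/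
open Filter Topology

/-- The relator `a·b·a⁻¹·d·c·d⁻¹` in the free group on four generators
`a = of 0`, `b = of 1`, `c = of 2`, `d = of 3`. -/
def theRel : Set (FreeGroup (Fin 4)) :=
  {FreeGroup.of 0 * FreeGroup.of 1 * (FreeGroup.of 0)⁻¹ *
    FreeGroup.of 3 * FreeGroup.of 2 * (FreeGroup.of 3)⁻¹}

/-- The group `G = ⟨a,b,c,d | aba⁻¹dcd⁻¹⟩`. -/
abbrev ExGroup := PresentedGroup theRel

/-- The images of the generators `a, b, c, d` in `ExGroup`. -/
def gen (i : Fin 4) : ExGroup := PresentedGroup.of i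

/-- The symmetric generating set `S = {a, b, c, d, a⁻¹, b⁻¹, c⁻¹, d⁻¹}`. -/
def genS : Set ExGroup := {g | ∃ i : Fin 4, g = gen i ∨ g = (gen i)⁻¹}


namespace Lad18

/-- Types of vertices of the ladder. -/
inductive Ty
  | u | p | v

instance : DecidableEq Ty := fun x y => by
  cases x <;> cases y <;> first | exact isTrue rfl | exact isFalse (fun h => by cases h)

abbrev F := FreeGroup (Fin 3)

def shiftL (k : ℤ) (x : ℤ × Ty) : ℤ × Ty := (k + x.1, x.2)

/-- Scan a word: leading `b`-run and the letter after it. -/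
def scan : List (Fin 3 × Bool) → ℤ × Ty
  | [] => (0, Ty.u)
  | (i, e) :: l =>
    if i = 1 then (if e then shiftL 1 (scan l) else shiftL (-1) (scan l))
    else if i = 0 then (if e then (0, Ty.u) else (0, Ty.p))
    else (if e then (0, Ty.v) else (0, Ty.u))

def fa : F := FreeGroup.of 0
def fb : F := FreeGroup.of 1
def ft : F := FreeGroup.of 2

def hair : Ty → F
  | Ty.u => 1
  | Ty.p => fa⁻¹
  | Ty.v => ft

def J (x : ℤ × Ty) : F := fb ^ x.1 * hair x.2

def P (g : F) : ℤ × Ty := scan g.toWord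

lemma J_shift (k : ℤ) (x : ℤ × Ty) : J (shiftL k x) = fb ^ k * J x := by
  simp [J, shiftL, zpow_add, mul_assoc]

lemma mk_b_cons (l : List (Fin 3 × Bool)) :
    (FreeGroup.mk ((1, true) :: l) : F) = fb ^ (1:ℤ) * FreeGroup.mk l := by
  simp [fb, FreeGroup.of]

lemma mk_b_cons' (l : List (Fin 3 × Bool)) :
    (FreeGroup.mk ((1, false) :: l) : F) = fb ^ (-1:ℤ) * FreeGroup.mk l := by
  simp [fb, FreeGroup.of, FreeGroup.invRev]

lemma scan_snoc (w : List (Fin 3 × Bool)) (s : Fin 3 × Bool) :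
    scan (w ++ [s]) = scan w ∨
      (FreeGroup.mk w = J (scan w) ∧ FreeGroup.mk (w ++ [s]) = J (scan (w ++ [s]))) := by
  induction w with
  | nil =>
    obtain ⟨i, e⟩ := s
    fin_cases i <;> cases e <;>
      simp [scan, J, hair, shiftL, fa, fb, ft, FreeGroup.of, FreeGroup.invRev,
        FreeGroup.one_eq_mk]
  | cons x l ih =>
    obtain ⟨i, e⟩ := x
    by_cases hi : i = 1
    · subst hi
      cases e
      · rcases ih with ih | ⟨h1, h2⟩
        · left; simp [scan, ih]
        · right
          rw [List.cons_append, mk_b_cons', mk_b_cons', h1, h2]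
          simp [scan, J_shift]
      · rcases ih with ih | ⟨h1, h2⟩
        · left; simp [scan, ih]
        · right
          rw [List.cons_append, mk_b_cons, mk_b_cons, h1, h2]
          simp [scan, J_shift]
    · left; simp [scan, hi]

lemma toWord_mk_cons (x : Fin 3 × Bool) (g : F) :
    (FreeGroup.mk [x] * g).toWord = x :: g.toWord ∨
      g.toWord = (x.1, !x.2) :: (FreeGroup.mk [x] * g).toWord := by
  have h : (FreeGroup.mk [x] * g).toWord = FreeGroup.reduce (x :: g.toWord) := by
    conv_lhs => rw [← FreeGroup.mk_toWord (x := g)]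
    rw [FreeGroup.mul_mk, FreeGroup.toWord_mk]; rfl
  rw [h, FreeGroup.reduce.cons, FreeGroup.reduce_toWord]
  obtain ⟨i, e⟩ := x
  cases hw : g.toWord with
  | nil => simp
  | cons y l =>
    obtain ⟨j, f⟩ := y
    simp only
    split_ifs with hc
    · right
      obtain ⟨h1, h2⟩ := hc
      subst h1; subst h2; simp
    · left; rfl

lemma toWord_mul_mk (g : F) (i : Fin 3) :
    (g * FreeGroup.of i).toWord = g.toWord ++ [(i, true)] ∨
      g.toWord = (g * FreeGroup.of i).toWord ++ [(i, false)] := by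
  have h := toWord_mk_cons (i, false) g⁻¹
  have e : (FreeGroup.mk [(i, false)] : F) * g⁻¹ = (g * FreeGroup.of i)⁻¹ := by
    simp [FreeGroup.of, FreeGroup.invRev]
  rw [e, FreeGroup.toWord_inv, FreeGroup.toWord_inv] at h
  rcases h with h | h
  · left
    have := congrArg FreeGroup.invRev h
    rw [FreeGroup.invRev_invRev] at this
    rw [this]
    simp [FreeGroup.invRev, Function.comp_def]
  · right
    have := congrArg FreeGroup.invRev h
    rw [FreeGroup.invRev_invRev] at this
    rw [this]
    simp [FreeGroup.invRev, Function.comp_def]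

lemma P_step (g : F) (i : Fin 3) :
    P (g * FreeGroup.of i) = P g ∨ g = J (P g) := by
  rcases toWord_mul_mk g i with h | h
  · rcases scan_snoc g.toWord (i, true) with h1 | ⟨h1, -⟩
    · left; rw [P, h, h1]; rfl
    · right; rw [FreeGroup.mk_toWord] at h1; exact h1
  · rcases scan_snoc (g * FreeGroup.of i).toWord (i, false) with h1 | ⟨-, h1⟩
    · left; rw [← h] at h1; exact h1.symm
    · right; rw [← h, FreeGroup.mk_toWord] at h1; exact h1

lemma P_b (g : F) : P (fb * g) = shiftL 1 (P g) := by
  rcases toWord_mk_cons (1, true) g with h | h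
  · change scan (FreeGroup.mk [(1, true)] * g).toWord = _
    rw [h]; simp [scan, P]
  · change scan (FreeGroup.mk [(1, true)] * g).toWord = _
    rw [P, h]; simp [scan, shiftL]

lemma P_zpow (n : ℤ) (g : F) : P (fb ^ n * g) = shiftL n (P g) := by
  induction n using Int.induction_on with
  | zero => simp [shiftL]
  | succ n ih =>
    have : fb ^ ((n:ℤ) + 1) * g = fb * (fb ^ (n:ℤ) * g) := by
      rw [← mul_assoc, ← zpow_one_add, add_comm]
    rw [this, P_b, ih]; ext <;> simp [shiftL]; ring
  | pred n ih =>
    have : fb * (fb ^ (-(n:ℤ) - 1) * g) = fb ^ (-(n:ℤ)) * g := by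
      rw [← mul_assoc, ← zpow_one_add]; congr 2; ring
    have h2 := P_b (fb ^ (-(n:ℤ) - 1) * g)
    rw [this, ih] at h2
    simp only [shiftL, Prod.mk.injEq] at h2
    ext
    · simp only [shiftL]; linarith [h2.1]
    · exact h2.2.symm

lemma P_hair (i : Ty) : P (hair i) = (0, i) := by
  cases i <;> simp [P, hair, fa, ft, scan, FreeGroup.toWord_inv, FreeGroup.invRev]

lemma P_J (x : ℤ × Ty) : P (J x) = x := by
  rw [J, P_zpow, P_hair]; simp [shiftL]

lemma P_hair_step (i : Ty) (k : Fin 3) (h : P (hair i * FreeGroup.of k) ≠ P (hair i)) :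
    (k = 0 ∧ i = Ty.p) ∨ (k = 1 ∧ i = Ty.u) ∨ (k = 2 ∧ i = Ty.u) := by
  revert h
  fin_cases k <;> cases i <;> simp <;> decide

lemma P_step' (g : F) (k : Fin 3) : P (g * FreeGroup.of k) = P g ∨
    ∃ n : ℤ, (k = 0 ∧ g = fb ^ n * fa⁻¹) ∨ (k = 1 ∧ g = fb ^ n) ∨ (k = 2 ∧ g = fb ^ n) := by
  by_cases hg : P (g * FreeGroup.of k) = P g
  · exact Or.inl hg
  right
  have h := (P_step g k).resolve_left hg
  obtain ⟨⟨n, i⟩, hx⟩ : ∃ x, g = J x := ⟨_, h⟩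
  subst hx
  refine ⟨n, ?_⟩
  have := P_hair_step i k (by
    intro h'; apply hg
    simp only [J]; rw [mul_assoc, P_zpow, P_zpow, h'])
  rcases this with ⟨rfl, rfl⟩ | ⟨rfl, rfl⟩ | ⟨rfl, rfl⟩ <;> simp [J, hair]

/-! ### Ladder metric -/

def cc : Ty → Ty → ℕ
  | Ty.u, Ty.u => 0
  | Ty.u, Ty.p => 1
  | Ty.u, Ty.v => 2
  | Ty.p, Ty.u => 1
  | Ty.p, Ty.p => 0
  | Ty.p, Ty.v => 1
  | Ty.v, Ty.u => 2
  | Ty.v, Ty.p => 1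
  | Ty.v, Ty.v => 0

def D (x y : ℤ × Ty) : ℕ :=
  (x.1 - y.1).natAbs + cc x.2 y.2 + if x.2 = Ty.p ∧ y.2 = Ty.p ∧ x.1 ≠ y.1 then 2 else 0

def Adj (x y : ℤ × Ty) : Prop := ∀ q, D q x ≤ D q y + 1 ∧ D q y ≤ D q x + 1

lemma Adj.symm {x y : ℤ × Ty} (h : Adj x y) : Adj y x := fun q => ⟨(h q).2, (h q).1⟩

lemma adj_pu (n : ℤ) : Adj (n, Ty.p) (n, Ty.u) := by
  rintro ⟨m, i⟩; cases i <;> simp [D, cc] <;> (try split_ifs) <;> omega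
lemma adj_pv (n : ℤ) : Adj (n, Ty.p) (n, Ty.v) := by
  rintro ⟨m, i⟩; cases i <;> simp [D, cc] <;> (try split_ifs) <;> omega
lemma adj_uu (n : ℤ) : Adj (n, Ty.u) (n + 1, Ty.u) := by
  rintro ⟨m, i⟩; cases i <;> simp [D, cc] <;> omega
lemma adj_vv (n : ℤ) : Adj (n, Ty.v) (n + 1, Ty.v) := by
  rintro ⟨m, i⟩; cases i <;> simp [D, cc] <;> omega

/-! ### Transfer to `ExGroup` -/

def fgen : Fin 4 → F := ![fa, fb, ft⁻¹ * fb⁻¹ * ft, fa * ft]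

def phi : ExGroup →* F := PresentedGroup.toGroup (f := fgen) (by
  intro r hr
  rw [theRel, Set.mem_singleton_iff] at hr
  subst hr
  simp [fgen]; group)

lemma phi_gen (i : Fin 4) : phi (gen i) = fgen i := PresentedGroup.toGroup.of _

lemma rel : gen 0 * gen 1 * (gen 0)⁻¹ * gen 3 * gen 2 * (gen 3)⁻¹ = 1 := by
  have : (PresentedGroup.mk theRel) (FreeGroup.of 0 * FreeGroup.of 1 * (FreeGroup.of 0)⁻¹ *
    FreeGroup.of 3 * FreeGroup.of 2 * (FreeGroup.of 3)⁻¹) = 1 :=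
    PresentedGroup.one_of_mem rfl
  simp only [map_mul, map_inv] at this
  exact this

lemma rel' : gen 2 = ((gen 0)⁻¹ * gen 3)⁻¹ * (gen 1)⁻¹ * ((gen 0)⁻¹ * gen 3) := by
  have h := rel
  have : gen 0 * gen 1 * (gen 0)⁻¹ * gen 3 * gen 2 = gen 3 := by
    rwa [mul_inv_eq_one] at h
  rw [← eq_inv_mul_iff_mul_eq] at this
  rw [this]; group

def psi : F →* ExGroup := FreeGroup.lift ![gen 0, gen 1, (gen 0)⁻¹ * gen 3]

lemma psi_phi (g : ExGroup) : psi (phi g) = g := by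
  have : psi.comp phi = MonoidHom.id ExGroup := by
    apply PresentedGroup.ext
    intro i
    change psi (phi (gen i)) = gen i
    rw [phi_gen]
    fin_cases i
    · simp [fgen, psi, fa]
    · simp [fgen, psi, fb]
    · simp only [fgen, psi, ft, fb]
      have := rel'
      simp at this ⊢
      exact this.symm
    · simp [fgen, psi, fa, ft]
  exact DFunLike.congr_fun this g

lemma phi_inj : Function.Injective phi := Function.LeftInverse.injective psi_phi

def io (x : ℤ × Ty) : ExGroup := psi (J x)

lemma phi_psi (f : F) : phi (psi f) = f := by
  have : phi.comp psi = MonoidHom.id F := by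
    apply FreeGroup.ext_hom
    intro i
    fin_cases i <;> simp [psi, phi_gen, fgen, fa, fb, ft]
  exact DFunLike.congr_fun this f

def Q (g : ExGroup) : ℤ × Ty := P (phi g)

lemma Q_io (x : ℤ × Ty) : Q (io x) = x := by rw [Q, io, phi_psi, P_J]

lemma eq_io {g : ExGroup} {x : ℤ × Ty} (h : phi g = J x) : g = io x := by
  rw [io, ← h, psi_phi]

lemma J_u (n : ℤ) : J (n, Ty.u) = fb ^ n := by simp [J, hair]
lemma J_p (n : ℤ) : J (n, Ty.p) = fb ^ n * fa⁻¹ := by simp [J, hair]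
lemma J_v (n : ℤ) : J (n, Ty.v) = fb ^ n * ft := by simp [J, hair]

lemma st_a (g : F) : P (g * fa) = P g ∨ ∃ n : ℤ, g = fb ^ n * fa⁻¹ := by
  rcases P_step' g 0 with h | ⟨n, h⟩
  · exact Or.inl h
  · right; use n; simpa using h
lemma st_b (g : F) : P (g * fb) = P g ∨ ∃ n : ℤ, g = fb ^ n := by
  rcases P_step' g 1 with h | ⟨n, h⟩
  · exact Or.inl h
  · right; use n; simpa using h
lemma st_t (g : F) : P (g * ft) = P g ∨ ∃ n : ℤ, g = fb ^ n := by
  rcases P_step' g 2 with h | ⟨n, h⟩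
  · exact Or.inl h
  · right; use n; simpa using h

lemma st_d (g : F) : P (g * (fa * ft)) = P g ∨ ∃ n : ℤ, g = fb ^ n * fa⁻¹ := by
  rcases st_a g with h | h
  · rcases st_t (g * fa) with h' | ⟨n, h'⟩
    · left; rw [← mul_assoc, h', h]
    · right; exact ⟨n, by rw [← h']; group⟩
  · exact Or.inr h

lemma st_c (g : F) : P (g * (ft⁻¹ * fb⁻¹ * ft)) = P g ∨ ∃ n : ℤ, g = fb ^ n * ft := by
  rcases st_t (g * ft⁻¹) with h1 | ⟨n, h1⟩
  · rcases st_b (g * ft⁻¹ * fb⁻¹) with h2 | ⟨n, h2⟩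
    · rcases st_t (g * ft⁻¹ * fb⁻¹) with h3 | ⟨n, h3⟩
      · left
        rw [inv_mul_cancel_right] at h1 h2
        rw [← mul_assoc, ← mul_assoc, h3, ← h2, ← h1]
      · right; exact ⟨n + 1, by rw [zpow_add_one, ← h3]; group⟩
    · right; exact ⟨n + 1, by rw [zpow_add_one, ← h2]; group⟩
  · right; exact ⟨n, by rw [← h1]; group⟩

lemma Q_gen (g : ExGroup) (i : Fin 4) : Q (g * gen i) = Q g ∨
    ∃ x y, g = io x ∧ g * gen i = io y ∧ Adj x y := by
  simp only [Q, map_mul, phi_gen]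
  fin_cases i
  · rcases st_a (phi g) with h | ⟨n, h⟩
    · exact Or.inl h
    · right
      refine ⟨(n, Ty.p), (n, Ty.u), eq_io (by rw [h, J_p]), eq_io ?_, adj_pu n⟩
      rw [map_mul, h, J_u, phi_gen]; simp [fgen]
  · rcases st_b (phi g) with h | ⟨n, h⟩
    · exact Or.inl h
    · right
      refine ⟨(n, Ty.u), (n + 1, Ty.u), eq_io (by rw [h, J_u]), eq_io ?_, adj_uu n⟩
      rw [map_mul, h, J_u, phi_gen]; simp [fgen, zpow_add_one]
  · rcases st_c (phi g) with h | ⟨n, h⟩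
    · exact Or.inl h
    · right
      refine ⟨(n, Ty.v), (n - 1, Ty.v), eq_io (by rw [h, J_v]), eq_io ?_, ?_⟩
      · rw [map_mul, h, J_v, phi_gen]; simp [fgen, zpow_sub_one, mul_assoc]
      · have := (adj_vv (n - 1)).symm
        simpa using this
  · rcases st_d (phi g) with h | ⟨n, h⟩
    · exact Or.inl h
    · right
      refine ⟨(n, Ty.p), (n, Ty.v), eq_io (by rw [h, J_p]), eq_io ?_, adj_pv n⟩
      rw [map_mul, h, J_v, phi_gen]; simp [fgen, mul_assoc]

lemma Q_S (g s : ExGroup) (hs : s ∈ genS) : Q (g * s) = Q g ∨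
    (g = io (Q g) ∧ Adj (Q g) (Q (g * s))) := by
  obtain ⟨i, rfl | rfl⟩ := hs
  · rcases Q_gen g i with h | ⟨x, y, h1, h2, h3⟩
    · exact Or.inl h
    · right; rw [h2, h1, Q_io, Q_io]; exact ⟨rfl, h3⟩
  · rcases Q_gen (g * (gen i)⁻¹) i with h | ⟨x, y, h1, h2, h3⟩
    · left; rw [inv_mul_cancel_right] at h; exact h.symm
    · right; rw [inv_mul_cancel_right] at h2; rw [h1, h2, Q_io, Q_io]; exact ⟨rfl, h3.symm⟩

/-! ### Word metric -/

noncomputable abbrev ρ (g h : ExGroup) : ℕ := wordDist genS g h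

lemma inv_S {s : ExGroup} (hs : s ∈ genS) : s⁻¹ ∈ genS := by
  obtain ⟨i, rfl | rfl⟩ := hs
  · exact ⟨i, Or.inr rfl⟩
  · exact ⟨i, Or.inl (inv_inv _)⟩

lemma exists_list (g : ExGroup) : ∃ l : List ExGroup, (∀ x ∈ l, x ∈ genS) ∧ l.prod = g := by
  have hg : g ∈ Subgroup.closure genS := by
    have : (⊤ : Subgroup ExGroup) ≤ Subgroup.closure genS := by
      rw [← PresentedGroup.closure_range_of]
      apply Subgroup.closure_mono
      rintro _ ⟨i, rfl⟩
      exact ⟨i, Or.inl rfl⟩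
    exact this trivial
  rw [← Subgroup.mem_toSubmonoid, Subgroup.closure_toSubmonoid] at hg
  obtain ⟨l, h1, h2⟩ := Submonoid.exists_list_of_mem_closure hg
  refine ⟨l, fun x hx => ?_, h2⟩
  rcases h1 x hx with h | h
  · exact h
  · simpa using inv_S h

lemma rho_spec (g h : ExGroup) :
    ∃ l : List ExGroup, l.length = ρ g h ∧ (∀ x ∈ l, x ∈ genS) ∧ l.prod = g⁻¹ * h := by
  obtain ⟨l, h1, h2⟩ := exists_list (g⁻¹ * h)
  exact Nat.sInf_mem (s := {n | ∃ l : List ExGroup, l.length = n ∧ (∀ x ∈ l, x ∈ genS) ∧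
    l.prod = g⁻¹ * h}) ⟨l.length, l, rfl, h1, h2⟩

lemma rho_le (g h : ExGroup) (l : List ExGroup) (h1 : ∀ x ∈ l, x ∈ genS)
    (h2 : g * l.prod = h) : ρ g h ≤ l.length :=
  Nat.sInf_le ⟨l, rfl, h1, by rw [← h2]; group⟩

lemma rho_triangle (x y z : ExGroup) : ρ x z ≤ ρ x y + ρ y z := by
  obtain ⟨l, a1, a2, a3⟩ := rho_spec x y
  obtain ⟨m, b1, b2, b3⟩ := rho_spec y z
  rw [← a1, ← b1, ← List.length_append]
  apply rho_le
  · intro s hs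
    rcases List.mem_append.1 hs with h | h
    · exact a2 s h
    · exact b2 s h
  · rw [List.prod_append, a3, b3]; group

lemma rho_comm_le (x y : ExGroup) : ρ x y ≤ ρ y x := by
  obtain ⟨l, a1, a2, a3⟩ := rho_spec y x
  have : (l.map (·⁻¹)).reverse.length = ρ y x := by simp [a1]
  rw [← this]
  apply rho_le
  · intro s hs
    simp only [List.mem_reverse, List.mem_map] at hs
    obtain ⟨t, ht, rfl⟩ := hs
    exact inv_S (a2 t ht)
  · rw [← List.prod_inv_reverse, a3]; group

lemma rho_comm (x y : ExGroup) : ρ x y = ρ y x := le_antisymm (rho_comm_le _ _) (rho_comm_le _ _)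

lemma rho_self (x : ExGroup) : ρ x x = 0 :=
  Nat.le_zero.1 (rho_le x x [] (by simp) (by simp))

lemma split_list (l : List ExGroup) (hl : ∀ s ∈ l, s ∈ genS) : ∀ x : ExGroup,
    Q (x * l.prod) ≠ Q x → ρ x (io (Q x)) + ρ (io (Q x)) (x * l.prod) ≤ l.length := by
  intro x hne
  suffices h : ∃ l1 l2, l = l1 ++ l2 ∧ x * l1.prod = io (Q x) by
    obtain ⟨l1, l2, rfl, h⟩ := h
    have h1 := rho_le x (io (Q x)) l1 (fun s hs => hl s (by simp [hs])) h
    have h2 := rho_le (io (Q x)) (x * (l1 ++ l2).prod) l2 (fun s hs => hl s (by simp [hs]))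
      (by rw [← h, List.prod_append, mul_assoc])
    rw [List.length_append]; omega
  induction l generalizing x with
  | nil => simp at hne
  | cons s l ih =>
    rcases Q_S x s (hl s (by simp)) with h | h
    · obtain ⟨l1, l2, e, h'⟩ := ih (fun t ht => hl t (by simp [ht])) (x * s)
        (by rw [h]; simpa [mul_assoc] using hne)
      refine ⟨s :: l1, l2, by simp [e], ?_⟩
      rw [← h, ← h']; simp [mul_assoc]
    · exact ⟨[], s :: l, rfl, by simpa using h.1⟩

lemma rho_through {x y : ExGroup} (h : Q x ≠ Q y) :
    ρ x y = ρ x (io (Q x)) + ρ (io (Q x)) y := by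
  apply le_antisymm (rho_triangle _ _ _)
  obtain ⟨l, a1, a2, a3⟩ := rho_spec x y
  have e : x * l.prod = y := by rw [a3]; group
  have := split_list l a2 x (by rw [e]; exact h.symm)
  rw [e, a1] at this
  exact this

lemma D_lip (q : ℤ × Ty) (l : List ExGroup) (hl : ∀ s ∈ l, s ∈ genS) : ∀ x : ExGroup,
    D q (Q (x * l.prod)) ≤ D q (Q x) + l.length := by
  induction l with
  | nil => simp
  | cons s l ih =>
    intro x
    have h1 := ih (fun t ht => hl t (by simp [ht])) (x * s)
    have h2 : D q (Q (x * s)) ≤ D q (Q x) + 1 := by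
      rcases Q_S x s (hl s (by simp)) with h | h
      · rw [h]; omega
      · exact (h.2 q).2
    rw [List.prod_cons, ← mul_assoc, List.length_cons]; omega

lemma D_self (q : ℤ × Ty) : D q q = 0 := by
  obtain ⟨m, i⟩ := q; cases i <;> simp [D, cc]

lemma D_le (x y : ExGroup) : D (Q x) (Q y) ≤ ρ x y := by
  obtain ⟨l, a1, a2, a3⟩ := rho_spec x y
  have e : x * l.prod = y := by rw [a3]; group
  have := D_lip (Q x) l a2 x
  rw [e, a1, D_self] at this; omega

lemma io_u (n : ℤ) : io (n, Ty.u) = gen 1 ^ n := by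
  rw [io, J_u]; simp [psi, fb]
lemma io_p (n : ℤ) : io (n, Ty.p) = gen 1 ^ n * (gen 0)⁻¹ := by
  rw [io, J_p]; simp [psi, fb, fa]
lemma io_v (n : ℤ) : io (n, Ty.v) = gen 1 ^ n * ((gen 0)⁻¹ * gen 3) := by
  rw [io, J_v]; simp [psi, fb, ft]

lemma gen_S (i : Fin 4) : gen i ∈ genS := ⟨i, Or.inl rfl⟩

lemma rho_one {x y s : ExGroup} (hs : s ∈ genS) (h : x * s = y) : ρ x y ≤ 1 :=
  rho_le x y [s] (by simpa using hs) (by simpa using h)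

lemma rho_zpow {s : ExGroup} (hs : s ∈ genS) (x y : ExGroup) (n : ℤ) (h : x * s ^ n = y) :
    ρ x y ≤ n.natAbs := by
  rcases Int.natAbs_eq n with e | e
  · have := rho_le x y (List.replicate n.natAbs s)
      (fun t ht => by rw [List.eq_of_mem_replicate ht]; exact hs)
      (by rw [List.prod_replicate, ← zpow_natCast, ← e, h])
    simpa using this
  · have := rho_le x y (List.replicate n.natAbs s⁻¹)
      (fun t ht => by rw [List.eq_of_mem_replicate ht]; exact inv_S hs)
      (by rw [List.prod_replicate, ← zpow_natCast, inv_zpow', ← e, h])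
    simpa using this

lemma rho_uu (m n : ℤ) : ρ (io (m, Ty.u)) (io (n, Ty.u)) ≤ (m - n).natAbs := by
  rw [← Int.natAbs_neg, neg_sub]
  apply rho_zpow (gen_S 1)
  rw [io_u, io_u, ← zpow_add]; congr 1; ring

lemma rho_vv (m n : ℤ) : ρ (io (m, Ty.v)) (io (n, Ty.v)) ≤ (m - n).natAbs := by
  apply rho_zpow (gen_S 2)
  have e : gen 2 ^ (m - n) = ((gen 0)⁻¹ * gen 3)⁻¹ * (gen 1) ^ (n - m) * ((gen 0)⁻¹ * gen 3) := by
    have h := rel'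
    have h2 := conj_zpow (i := m - n) (a := ((gen 0)⁻¹ * gen 3)⁻¹) (b := (gen 1)⁻¹)
    rw [inv_inv, ← h] at h2
    rw [h2, inv_zpow', neg_sub]
  rw [e, io_v, io_v]
  have : gen 1 ^ n = gen 1 ^ m * gen 1 ^ (n - m) := by rw [← zpow_add]; congr 1; ring
  rw [this]; group

lemma rho_pu (n : ℤ) : ρ (io (n, Ty.p)) (io (n, Ty.u)) ≤ 1 :=
  rho_one (gen_S 0) (by rw [io_p, io_u]; group)
lemma rho_pv (n : ℤ) : ρ (io (n, Ty.p)) (io (n, Ty.v)) ≤ 1 :=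
  rho_one (gen_S 3) (by rw [io_p, io_v]; group)

lemma rho_le_D (x y : ℤ × Ty) : ρ (io x) (io y) ≤ D x y := by
  obtain ⟨m, i⟩ := x
  obtain ⟨n, j⟩ := y
  have a1 := rho_pu m
  have a2 := rho_pu n
  have a3 := rho_pv m
  have a4 := rho_pv n
  have b1 := rho_comm (io (m, Ty.p)) (io (m, Ty.u))
  have b2 := rho_comm (io (n, Ty.p)) (io (n, Ty.u))
  have b3 := rho_comm (io (m, Ty.p)) (io (m, Ty.v))
  have b4 := rho_comm (io (n, Ty.p)) (io (n, Ty.v))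
  have c1 := rho_uu m n
  have c2 := rho_vv m n
  have t := fun i j k => rho_triangle (io (m, i)) (io (m, j)) (io (n, k))
  have t' := fun i j k => rho_triangle (io (m, i)) (io (n, j)) (io (n, k))
  cases i <;> cases j <;> simp only [D, cc]
  · simpa using c1
  · have := t' Ty.u Ty.u Ty.p; simp; omega
  · have := t' Ty.u Ty.u Ty.p; have := t' Ty.u Ty.p Ty.v; simp; omega
  · have := t Ty.p Ty.u Ty.u; simp; omega
  · by_cases h : m = n
    · subst h; simp [rho_self]
    · have := t' Ty.p Ty.u Ty.p; have := t Ty.p Ty.u Ty.u; simp [h]; omega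
  · have := t Ty.p Ty.v Ty.v; simp; omega
  · have := t Ty.v Ty.p Ty.u; have := t Ty.p Ty.u Ty.u; simp; omega
  · have := t' Ty.v Ty.v Ty.p; simp; omega
  · simpa using c2

lemma rho_io (x y : ℤ × Ty) : ρ (io x) (io y) = D x y := by
  apply le_antisymm (rho_le_D x y)
  have := D_le (io x) (io y)
  rwa [Q_io, Q_io] at this

lemma rho_lad (x : ExGroup) (y : ℤ × Ty) : ρ x (io y) = ρ x (io (Q x)) + D (Q x) y := by
  by_cases h : Q x = y
  · rw [h, D_self]; rfl
  · rw [rho_through (by rwa [Q_io]), rho_io]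

lemma rho_full {x y : ExGroup} (h : Q x ≠ Q y) :
    ρ x y = ρ x (io (Q x)) + D (Q x) (Q y) + ρ y (io (Q y)) := by
  rw [rho_through h, rho_comm (io (Q x)) y, rho_lad y (Q x), ← rho_io, ← rho_io, 
    rho_comm (io (Q y)) (io (Q x))]
  omega

/-! ### The ray -/

noncomputable def ray (t : ℝ) : ExGroup := if t = 0 then io (0, Ty.u) else io (⌊t⌋ - 1, Ty.p)

def dom : Set ℝ := Set.range (fun n : ℕ => (n : ℝ))

lemma ray_succ (n : ℕ) : ray ((n + 1 : ℕ) : ℝ) = io (n, Ty.p) := by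
  rw [ray, if_neg (by positivity), Int.floor_natCast]; simp

lemma ray_zero : ray 0 = io (0, Ty.u) := by simp [ray]

lemma dom_ray : IsRayDomain dom := by
  refine ⟨?_, ⟨0, by simp⟩, fun M => ?_⟩
  · rintro _ ⟨n, rfl⟩; simp
  · obtain ⟨n, hn⟩ := exists_nat_gt M
    exact ⟨n, ⟨n, rfl⟩, hn⟩

/-- Eventual distance from the ray. -/
lemma ray_dist (y : ExGroup) : ∃ (N : ℕ) (C : ℤ), ∀ n : ℕ, N ≤ n →
    (ρ (ray n) y : ℤ) = n + C := by
  refine ⟨(Q y).1.natAbs + 2,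
    ρ y (io (Q y)) - 1 - (Q y).1 + cc (Q y).2 Ty.p + (if (Q y).2 = Ty.p then 2 else 0), ?_⟩
  intro n hn
  obtain ⟨k, rfl⟩ : ∃ k, n = k + 1 := ⟨n - 1, by omega⟩
  rw [ray_succ, rho_comm, rho_lad]
  have : (Q y).1 ≠ (k : ℤ) := by omega
  simp only [D]
  by_cases h : (Q y).2 = Ty.p <;> simp [h, this, -Nat.cast_natAbs] <;> omega

lemma weak : WeaklyGeodesicRay (fun g h => (wordDist genS g h : ℝ)) dom ray := by
  intro y ε hε
  obtain ⟨N, C, h⟩ := ray_dist y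
  refine ⟨N, ?_⟩
  rintro _ ⟨m, rfl⟩ _ ⟨n, rfl⟩ hm hn
  simp only [Nat.cast_le] at hm hn
  have hm' : (ρ (ray m) y : ℝ) = m + C := by exact_mod_cast h m hm
  have hn' : (ρ (ray n) y : ℝ) = n + C := by exact_mod_cast h n hn
  constructor
  · have : ρ (ray n) (ray 0) = n := by
      rcases n with _ | n
      · simp [rho_self]
      · rw [ray_succ, ray_zero, rho_io]; simp [D, cc]
    simp only [this]; simpa using hε
  · simp only [hm', hn']
    rw [show (n + C - (m + C) - (n - m) : ℝ) = 0 by ring]; simpa using hε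

lemma ray_limit (y z : ExGroup) (c : ℤ) (N : ℕ)
    (h : ∀ n : ℕ, N ≤ n → (ρ (ray n) y : ℤ) - ρ (ray n) z = c) :
    RayLimit (fun g h => (wordDist genS g h : ℝ)) dom ray y z c := by
  apply tendsto_const_nhds.congr'
  rw [Filter.EventuallyEq, Filter.eventually_inf_principal]
  filter_upwards [Filter.eventually_ge_atTop (N : ℝ)]
  rintro _ hx ⟨n, rfl⟩
  have := h n (by simpa using hx)
  exact_mod_cast this.symm

lemma ray_uv : RayLimit (fun g h => (wordDist genS g h : ℝ)) dom ray
    (io (0, Ty.u)) (io (0, Ty.v)) (0 : ℤ) := by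
  apply ray_limit _ _ _ 1
  intro n hn
  obtain ⟨k, rfl⟩ : ∃ k, n = k + 1 := ⟨n - 1, by omega⟩
  rw [ray_succ, rho_io, rho_io]; simp [D, cc]

lemma ray_uu (m : ℕ) : RayLimit (fun g h => (wordDist genS g h : ℝ)) dom ray
    (io (0, Ty.u)) (io (m, Ty.u)) (m : ℤ) := by
  apply ray_limit _ _ _ (m + 1)
  intro n hn
  obtain ⟨k, rfl⟩ : ∃ k, n = k + 1 := ⟨n - 1, by omega⟩
  rw [ray_succ, rho_io, rho_io]; simp [D, cc, -Nat.cast_natAbs]; omega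

/-! ### Geodesic rays -/

section geo
variable {T : Set ℝ} {γ : ℝ → ExGroup}

lemma geo_lim1 (hT : IsRayDomain T)
    (hγ : GeodesicRay (fun g h => (wordDist genS g h : ℝ)) T γ) (y : ExGroup) :
    ∃ L : ℝ, Tendsto (fun t => (ρ (γ t) y : ℝ) - t) (atTop ⊓ 𝓟 T) (𝓝 L) := by
  set f : ℝ → ℝ := fun t => (ρ (γ t) y : ℝ) - t with hf
  have anti : ∀ s ∈ T, ∀ t ∈ T, s ≤ t → f t ≤ f s := by
    intro s hs t ht hst
    have h1 : (ρ (γ t) y : ℝ) ≤ ρ (γ t) (γ s) + ρ (γ s) y := by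
      exact_mod_cast rho_triangle _ _ _
    have h2 := hγ t ht s hs
    simp only at h2
    rw [abs_of_nonneg (by linarith)] at h2
    simp only [hf]; linarith
  have bdd : ∀ t ∈ T, -(ρ y (γ 0) : ℝ) ≤ f t := by
    intro t ht
    have h1 : (ρ (γ t) (γ 0) : ℝ) ≤ ρ (γ t) y + ρ y (γ 0) := by
      exact_mod_cast rho_triangle _ _ _
    have h2 := hγ t ht 0 hT.2.1
    simp only at h2
    rw [abs_of_nonneg (by linarith [hT.1 ht, Set.mem_Ici.1 (hT.1 ht)])] at h2
    simp only [hf]; linarith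
  have hb : BddBelow (f '' T) := ⟨_, by rintro _ ⟨t, ht, rfl⟩; exact bdd t ht⟩
  have hne : (f '' T).Nonempty := ⟨_, 0, hT.2.1, rfl⟩
  refine ⟨sInf (f '' T), ?_⟩
  rw [Metric.tendsto_nhds]
  intro ε hε
  obtain ⟨_, ⟨s, hs, rfl⟩, hlt⟩ := Real.lt_sInf_add_pos hne hε
  rw [Filter.eventually_inf_principal]
  filter_upwards [Filter.eventually_ge_atTop s] with t hst ht
  have h1 := csInf_le hb ⟨t, ht, rfl⟩
  have h2 := anti s hs t ht hst
  rw [Real.dist_eq, abs_lt]; constructor <;> linarith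

lemma geo_lim (hT : IsRayDomain T)
    (hγ : GeodesicRay (fun g h => (wordDist genS g h : ℝ)) T γ) (y z : ExGroup) :
    ∃ L : ℝ, RayLimit (fun g h => (wordDist genS g h : ℝ)) T γ y z L := by
  obtain ⟨L, h⟩ := geo_lim1 hT hγ y
  obtain ⟨M, h'⟩ := geo_lim1 hT hγ z
  refine ⟨L - M, (h.sub h').congr fun t => ?_⟩
  simp

lemma ev_of_limit {y z : ExGroup} {c : ℤ}
    (h : RayLimit (fun g h => (wordDist genS g h : ℝ)) T γ y z c) :
    ∃ N : ℝ, ∀ t ∈ T, N ≤ t → (ρ (γ t) y : ℤ) - ρ (γ t) z = c := by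
  have h1 := (Metric.tendsto_nhds.1 h) 1 one_pos
  rw [Filter.eventually_inf_principal, Filter.eventually_atTop] at h1
  obtain ⟨N, h1⟩ := h1
  refine ⟨N, fun t ht hN => ?_⟩
  have h2 := h1 t hN ht
  rw [Real.dist_eq] at h2
  simp only at h2
  have h3 : |((ρ (γ t) y : ℤ) - (ρ (γ t) z : ℤ)) - c| < 1 := by
    have : |((((ρ (γ t) y : ℤ) - (ρ (γ t) z : ℤ)) - c : ℤ) : ℝ)| < 1 := by
      push_cast; exact h2
    rw [← Int.cast_abs] at this
    exact_mod_cast this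
  have := Int.abs_lt_one_iff.1 h3
  linarith

lemma no_geo (hT : IsRayDomain T)
    (hγ : GeodesicRay (fun g h => (wordDist genS g h : ℝ)) T γ)
    (huv : RayLimit (fun g h => (wordDist genS g h : ℝ)) T γ
      (io (0, Ty.u)) (io (0, Ty.v)) (0 : ℤ))
    (huu : ∀ m : ℕ, RayLimit (fun g h => (wordDist genS g h : ℝ)) T γ
      (io (0, Ty.u)) (io (m, Ty.u)) (m : ℤ)) : False := by
  obtain ⟨N, hN⟩ := ev_of_limit huv
  have key : ∀ (m : ℕ) (K : ℝ), ∃ t ∈ T, K ≤ t ∧ (m : ℤ) ≤ (Q (γ t)).1 ∧ (Q (γ t)).2 = Ty.p := by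
    intro m K
    obtain ⟨M, hM⟩ := ev_of_limit (huu (m + 1))
    obtain ⟨t, ht, hlt⟩ := hT.2.2 (max K (max N M))
    rw [max_lt_iff, max_lt_iff] at hlt
    refine ⟨t, ht, hlt.1.le, ?_⟩
    have h1 := hN t ht hlt.2.1.le
    have h2 := hM t ht hlt.2.2.le
    rw [rho_lad (γ t) (0, Ty.u), rho_lad (γ t) (0, Ty.v)] at h1
    rw [rho_lad (γ t) (0, Ty.u), rho_lad (γ t) ((m + 1 : ℕ), Ty.u)] at h2
    generalize ρ (γ t) (io (Q (γ t))) = r at h1 h2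
    generalize Q (γ t) = q at h1 h2 ⊢
    obtain ⟨n, i⟩ := q
    cases i <;> simp [D, cc, -Nat.cast_natAbs] at h1 h2 ⊢ <;> omega
  obtain ⟨s, hs, hs0, hs1, hs2⟩ := key ((Q (γ 0)).1.natAbs + 1) 0
  obtain ⟨t, ht, hst, ht1, ht2⟩ := key ((Q (γ s)).1.natAbs + 1) s
  have e1 := hγ s hs 0 hT.2.1
  have e2 := hγ t ht 0 hT.2.1
  have e3 := hγ t ht s hs
  simp only at e1 e2 e3
  rw [abs_of_nonneg (by linarith)] at e1 e2 e3
  have e : ρ (γ t) (γ 0) = ρ (γ t) (γ s) + ρ (γ s) (γ 0) := by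
    have : (ρ (γ t) (γ 0) : ℝ) = ρ (γ t) (γ s) + ρ (γ s) (γ 0) := by linarith
    exact_mod_cast this
  have n1 : Q (γ s) ≠ Q (γ 0) := fun h => by rw [h] at hs1; omega
  have n2 : Q (γ t) ≠ Q (γ 0) := fun h => by rw [h] at ht1; omega
  have n3 : Q (γ t) ≠ Q (γ s) := fun h => by rw [h] at ht1; omega
  rw [rho_full n1, rho_full n2, rho_full n3] at e
  generalize Q (γ s) = qs at *
  generalize Q (γ t) = qt at *
  generalize Q (γ 0) = q0 at *
  obtain ⟨ms, is⟩ := qs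
  obtain ⟨mt, it⟩ := qt
  obtain ⟨m0, i0⟩ := q0
  simp only at hs2 ht2 hs1 ht1
  subst hs2; subst ht2
  have a1 : ms ≠ m0 := by omega
  have a2 : mt ≠ m0 := by omega
  have a3 : mt ≠ ms := by omega
  cases i0 <;> simp [D, cc, a1, a2, a3] at e <;> omega

end geo

end Lad18

/-- The metric boundary of the Cayley graph of
`G = ⟨a,b,c,d | aba⁻¹dcd⁻¹⟩` with the generating set `{a,b,c,d,a⁻¹,b⁻¹,c⁻¹,d⁻¹}`
contains a point which is not a Busemann point. -/
theorem stmt18 :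
    ∃ T : Set ℝ, ∃ γ : ℝ → ExGroup, IsRayDomain T ∧
      WeaklyGeodesicRay (fun g h => (wordDist genS g h : ℝ)) T γ ∧
      ∀ (T' : Set ℝ) (γ' : ℝ → ExGroup), IsRayDomain T' →
        GeodesicRay (fun g h => (wordDist genS g h : ℝ)) T' γ' →
        ∃ (y z : ExGroup) (L L' : ℝ),
          RayLimit (fun g h => (wordDist genS g h : ℝ)) T γ y z L ∧
          RayLimit (fun g h => (wordDist genS g h : ℝ)) T' γ' y z L' ∧ L ≠ L' := by
  refine ⟨Lad18.dom, Lad18.ray, Lad18.dom_ray, Lad18.weak, fun T' γ' hT hγ => ?_⟩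
  by_contra hcon
  push Not at hcon
  apply Lad18.no_geo hT hγ
  · obtain ⟨L', hL'⟩ := Lad18.geo_lim hT hγ (Lad18.io (0, Lad18.Ty.u)) (Lad18.io (0, Lad18.Ty.v))
    rw [hcon _ _ _ _ Lad18.ray_uv hL']; exact hL'
  · intro m
    obtain ⟨L', hL'⟩ := Lad18.geo_lim hT hγ (Lad18.io (0, Lad18.Ty.u)) (Lad18.io (m, Lad18.Ty.u))
    rw [hcon _ _ _ _ (Lad18.ray_uu m) hL']; exact hL'
end
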